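/- Let Σ be a rational pointed fan in ℝ^d and suppose the toric face ring K[Σ] is clean for some field K. Then Σ is shellable. More precisely, a clean prime filtration of K[Σ] induces a linear ordering C_1,…,C_s of the facets of Σ and elements γ_j ∈ C_j ∩ ℤ^d (1 < j ≤ s) such that str_{fan(C_j)}(γ_j) = fan(C_j) ∖ ⋃_{i=1}^{j-1} fan(C_i) and ⋃_{D ∈ str_{fan(C_j)}(γ_j)} relint(D) ∩ ℤ^d = γ_j + (C_j ∩ ℤ^d). -/

import Mathlib

open scoped BigOperators Classical

noncomputable section

/-- The coercion of an integer point to a real point. -/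
def Z2R {d : ℕ} (a : Fin d → ℤ) : Fin d → ℝ := fun i => (a i : ℝ)

/-- The conical hull of a finite set of vectors. -/
def conicalHull {d : ℕ} (S : Finset (Fin d → ℝ)) : Set (Fin d → ℝ) :=
  {x | ∃ c : (Fin d → ℝ) → ℝ, (∀ v, 0 ≤ c v) ∧ x = ∑ v ∈ S, c v • v}

/-- A rational (polyhedral) cone: the conical hull of finitely many rational vectors. -/
def IsRatCone {d : ℕ} (C : Set (Fin d → ℝ)) : Prop :=
  ∃ S : Finset (Fin d → ℝ), (∀ v ∈ S, ∀ i, ∃ q : ℚ, v i = (q : ℝ)) ∧ C = conicalHull S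

/-- A pointed cone contains no line. -/
def IsPointedSet {d : ℕ} (C : Set (Fin d → ℝ)) : Prop :=
  ∀ x ∈ C, -x ∈ C → x = 0

/-- A rational pointed cone. -/
def IsRatPointedCone {d : ℕ} (C : Set (Fin d → ℝ)) : Prop :=
  IsRatCone C ∧ IsPointedSet C

/-- A convex cone (containing the origin). -/
def IsConvexCone {d : ℕ} (C : Set (Fin d → ℝ)) : Prop :=
  0 ∈ C ∧ (∀ x ∈ C, ∀ y ∈ C, x + y ∈ C) ∧ ∀ x ∈ C, ∀ t : ℝ, 0 ≤ t → t • x ∈ C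

/-- `C'` is a face of the cone `C`. -/
def IsFaceOf {d : ℕ} (C' C : Set (Fin d → ℝ)) : Prop :=
  IsConvexCone C' ∧ C' ⊆ C ∧ ∀ x ∈ C, ∀ y ∈ C, x + y ∈ C' → x ∈ C' ∧ y ∈ C'

/-- A rational pointed fan in `ℝ^d`. -/
structure Fan (d : ℕ) where
  cones : Set (Set (Fin d → ℝ))
  finite : cones.Finite
  pointed : ∀ C ∈ cones, IsRatPointedCone C
  faces_mem : ∀ C ∈ cones, ∀ C', IsFaceOf C' C → C' ∈ cones
  inter_face : ∀ C ∈ cones, ∀ C' ∈ cones, IsFaceOf (C ∩ C') C ∧ IsFaceOf (C ∩ C') C'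

/-- The dimension of a cone. -/
def coneDim {d : ℕ} (C : Set (Fin d → ℝ)) : ℕ :=
  Module.finrank ℝ (Submodule.span ℝ C)

/-- The dimension of a fan. -/
def Fan.dim {d : ℕ} (Φ : Fan d) : ℕ := sSup (coneDim '' Φ.cones)

/-- The set of lattice points in the support of a fan. -/
def Fan.supp {d : ℕ} (Φ : Fan d) : Set (Fin d → ℤ) :=
  {a | ∃ C ∈ Φ.cones, Z2R a ∈ C}

/-- The relative interior of a cone. -/
def relint {d : ℕ} (C : Set (Fin d → ℝ)) : Set (Fin d → ℝ) := intrinsicInterior ℝ C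

section ToricFaceRing

variable (K : Type) [Field K] {d : ℕ} (Φ : Fan d)

/-- The ambient polynomial ring: the monoid algebra of the free commutative
monoid on the lattice points of the support of the fan. -/
abbrev Fan.polyRing := AddMonoidAlgebra K (↥Φ.supp →₀ ℕ)

/-- The monomial of the ambient polynomial ring corresponding to a lattice point. -/
def Fan.X (m : ↥Φ.supp) : Φ.polyRing K :=
  AddMonoidAlgebra.single (Finsupp.single m 1) (1 : K)

/-- Auxiliary monomial: zero if the point is not in the support. -/
def Fan.Xaux (a : Fin d → ℤ) : Φ.polyRing K :=
  if h : a ∈ Φ.supp then Φ.X K ⟨a, h⟩ else 0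

/-- The defining relations of the toric face ring. -/
def Fan.relIdeal : Ideal (Φ.polyRing K) :=
  Ideal.span
    ({z | ∃ a b : ↥Φ.supp, (∃ C ∈ Φ.cones, Z2R a.1 ∈ C ∧ Z2R b.1 ∈ C) ∧
        z = Φ.X K a * Φ.X K b - Φ.Xaux K (a.1 + b.1)} ∪
     {z | ∃ a b : ↥Φ.supp, (¬ ∃ C ∈ Φ.cones, Z2R a.1 ∈ C ∧ Z2R b.1 ∈ C) ∧
        z = Φ.X K a * Φ.X K b} ∪
     {z | ∃ a : ↥Φ.supp, a.1 = 0 ∧ z = Φ.X K a - 1})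

/-- The toric face ring `K[Φ]` of a rational pointed fan `Φ`. -/
def ToricFaceRing := Φ.polyRing K ⧸ Φ.relIdeal K

instance : CommRing (ToricFaceRing K Φ) := Ideal.Quotient.commRing _
instance : Algebra K (ToricFaceRing K Φ) := Ideal.Quotient.algebra K

/-- The monomial `x^a` of the toric face ring. -/
def xpow (a : Fin d → ℤ) : ToricFaceRing K Φ :=
  Ideal.Quotient.mk (Φ.relIdeal K) (Φ.Xaux K a)

/-- A `ℤ^d`-graded (monomial) ideal of the toric face ring. -/
def IsMonomialIdeal (I : Ideal (ToricFaceRing K Φ)) : Prop :=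
  ∃ S : Set (Fin d → ℤ), I = Ideal.span (xpow K Φ '' S)

/-- The graded prime ideal `𝔭_C` associated to a cone. -/
def conePrime (C : Set (Fin d → ℝ)) : Ideal (ToricFaceRing K Φ) :=
  Ideal.span (xpow K Φ '' {a | Z2R a ∉ C})

/-- The graded radical ideal `𝔮_{Σ'}` associated to a collection of cones. -/
def subfanIdeal (T : Set (Set (Fin d → ℝ))) : Ideal (ToricFaceRing K Φ) :=
  Ideal.span (xpow K Φ '' {a | Z2R a ∉ ⋃₀ T})

/-- The graded maximal ideal of the toric face ring. -/
def gradedMaxIdeal : Ideal (ToricFaceRing K Φ) :=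
  Ideal.span (xpow K Φ '' {a | a ≠ 0})

end ToricFaceRing
/-- A facet of a fan: a maximal cone. -/
def IsFacet {d : ℕ} (Φ : Fan d) (C : Set (Fin d → ℝ)) : Prop :=
  C ∈ Φ.cones ∧ ∀ D ∈ Φ.cones, C ⊆ D → D = C

/-- The set of faces of a cone `C` inside the fan `Φ`, i.e. the fan `fan(C)`. -/
def faceSet {d : ℕ} (Φ : Fan d) (C : Set (Fin d → ℝ)) : Set (Set (Fin d → ℝ)) :=
  {D ∈ Φ.cones | D ⊆ C}

/-- The set of proper faces of a cone `C` inside `Φ`, i.e. the fan `fan(∂C)`. -/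
def bdFaceSet {d : ℕ} (Φ : Fan d) (C : Set (Fin d → ℝ)) : Set (Set (Fin d → ℝ)) :=
  {D ∈ Φ.cones | D ⊆ C ∧ D ≠ C}

/-- Fuelled (by recursion depth) definition of a shelling of a fan. -/
def IsShellingAux {d : ℕ} : ℕ → Fan d → List (Set (Fin d → ℝ)) → Prop
  | 0, Φ, L => L.Nodup ∧ {C | C ∈ L} = {C | IsFacet Φ C} ∧ Fan.dim Φ = 0
  | n + 1, Φ, L => L.Nodup ∧ {C | C ∈ L} = {C | IsFacet Φ C} ∧
      (Fan.dim Φ = 0 ∨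
        ((∃ S1 : Fan d, S1.cones = bdFaceSet Φ (L.getD 0 ∅) ∧
            ∃ L1, IsShellingAux n S1 L1) ∧
         ∀ j, 0 < j → j < L.length →
           ∃ Sb : Fan d, Sb.cones = bdFaceSet Φ (L.getD j ∅) ∧
           ∃ D : List (Set (Fin d → ℝ)), IsShellingAux n Sb D ∧
           ∃ r, 1 ≤ r ∧ r ≤ D.length ∧
             (⋃ i ∈ Finset.range j,
                (faceSet Φ (L.getD i ∅) ∩ faceSet Φ (L.getD j ∅))) ≠ ∅ ∧
             (⋃ i ∈ Finset.range j,
                (faceSet Φ (L.getD i ∅) ∩ faceSet Φ (L.getD j ∅))) =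
               ⋃ l ∈ Finset.range r, faceSet Sb (D.getD l ∅)))

/-- A shelling of a fan. -/
def IsShelling {d : ℕ} (Φ : Fan d) (L : List (Set (Fin d → ℝ))) : Prop :=
  ∃ n, IsShellingAux n Φ L

/-- A fan is shellable if it has a shelling. -/
def IsShellable {d : ℕ} (Φ : Fan d) : Prop := ∃ L, IsShelling Φ L
/-- A commutative ring is clean if it admits a prime filtration whose set of prime
quotients is exactly the set of minimal primes. -/
def IsCleanRing (R : Type) [CommRing R] : Prop :=
  ∃ (n : ℕ) (M : Fin (n + 1) → Submodule R R) (P : Fin n → Ideal R),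
    M 0 = ⊥ ∧ M (Fin.last n) = ⊤ ∧ (∀ i : Fin n, M i.castSucc ≤ M i.succ) ∧
    (∀ i : Fin n,
      Nonempty ((↥(M i.succ) ⧸ Submodule.comap (M i.succ).subtype (M i.castSucc))
        ≃ₗ[R] (R ⧸ P i))) ∧
    {I : Ideal R | ∃ i, P i = I} = minimalPrimes R

open Module

/-! ### Finitely generated cones and their faces -/

/-- Farkas' lemma for finitely generated cones. -/
theorem exists_dual_neg_of_notMem_cone {ι V : Type*} [AddCommGroup V] [Module ℝ V]
    (s : Finset ι) (g : ι → V) (v : V)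
    (h : ¬ ∃ c : ι → ℝ, (∀ i, 0 ≤ c i) ∧ v = ∑ i ∈ s, c i • g i) :
    ∃ l : Dual ℝ V, (∀ i ∈ s, 0 ≤ l (g i)) ∧ l v < 0 := by
  induction s using Finset.induction_on generalizing g v with
  | empty =>
    have hv : v ∉ (⊥ : Submodule ℝ V) := by
      intro hv
      exact h ⟨0, fun _ => le_rfl, by simpa using hv⟩
    obtain ⟨f, hf, -⟩ := Submodule.exists_le_ker_of_notMem hv
    rcases lt_or_gt_of_ne hf with h1 | h1
    · exact ⟨f, by simp, h1⟩
    · exact ⟨-f, by simp, by simpa using h1⟩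
  | insert u s hu ih =>
    obtain ⟨l, hl, hlv⟩ := ih g v (by
      rintro ⟨c, hc, hv⟩
      refine h ⟨fun i => if i = u then 0 else c i, fun i => by
        dsimp only; split_ifs <;> simp [hc], ?_⟩
      rw [Finset.sum_insert hu, hv]
      simp only [if_true, zero_smul, zero_add]
      refine Finset.sum_congr rfl fun i hi => ?_
      rw [if_neg (by rintro rfl; exact hu hi)])
    by_cases hlu : 0 ≤ l (g u)
    · refine ⟨l, fun i hi => ?_, hlv⟩
      rcases Finset.mem_insert.1 hi with rfl | hi
      exacts [hlu, hl i hi]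
    push Not at hlu
    let p : V →ₗ[ℝ] V := LinearMap.id - (l.smulRight ((l (g u))⁻¹ • g u))
    have hp : ∀ x, p x = x - (l x * (l (g u))⁻¹) • g u := by
      intro x; simp [p, smul_smul]
    obtain ⟨m, hm, hmv⟩ := ih (fun i => p (g i)) (p v) (by
      rintro ⟨c, hc, hv⟩
      refine h ⟨fun i => if i = u then
        l v * (l (g u))⁻¹ - ∑ j ∈ s, c j * (l (g j) * (l (g u))⁻¹) else c i, fun i => ?_, ?_⟩
      · dsimp only
        split_ifs
        · have h1 : 0 ≤ l v * (l (g u))⁻¹ :=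
            mul_nonneg_of_nonpos_of_nonpos hlv.le (inv_nonpos.2 hlu.le)
          have h2 : ∑ j ∈ s, c j * (l (g j) * (l (g u))⁻¹) ≤ 0 :=
            Finset.sum_nonpos fun j hj => mul_nonpos_of_nonneg_of_nonpos (hc j)
              (mul_nonpos_of_nonneg_of_nonpos (hl j hj) (inv_nonpos.2 hlu.le))
          linarith
        · exact hc i
      · rw [Finset.sum_insert hu]
        have h3 : ∑ i ∈ s, (if i = u then
            l v * (l (g u))⁻¹ - ∑ j ∈ s, c j * (l (g j) * (l (g u))⁻¹) else c i) • g i =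
            ∑ i ∈ s, c i • g i := by
          refine Finset.sum_congr rfl fun i hi => ?_
          rw [if_neg (by rintro rfl; exact hu hi)]
        rw [h3]
        dsimp only
        rw [if_pos rfl]
        simp only [hp, smul_sub, Finset.sum_sub_distrib, smul_smul] at hv
        rw [← Finset.sum_smul] at hv
        rw [sub_smul]
        linear_combination (norm := module) hv)
    refine ⟨m ∘ₗ p, fun i hi => ?_, hmv⟩
    rcases Finset.mem_insert.1 hi with rfl | hi
    · simp [hp, hlu.ne]
    · exact hm i hi

section Cones

variable {d : ℕ}

theorem isConvexCone_conicalHull (S : Finset (Fin d → ℝ)) : IsConvexCone (conicalHull S) := by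
  refine ⟨⟨0, by simp, by simp⟩, ?_, ?_⟩
  · rintro _ ⟨c, hc, rfl⟩ _ ⟨e, he, rfl⟩
    exact ⟨c + e, fun v => add_nonneg (hc v) (he v), by simp [add_smul, Finset.sum_add_distrib]⟩
  · rintro _ ⟨c, hc, rfl⟩ t ht
    exact ⟨t • c, fun v => mul_nonneg ht (hc v), by simp [Finset.smul_sum, smul_smul]⟩

theorem subset_conicalHull (S : Finset (Fin d → ℝ)) : (S : Set (Fin d → ℝ)) ⊆ conicalHull S := by
  intro v hv
  refine ⟨fun w => if w = v then 1 else 0, fun w => by dsimp only; split_ifs <;> simp, ?_⟩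
  simp [ite_smul, Finset.sum_ite_eq', Finset.mem_coe.1 hv]

theorem IsConvexCone.sum_mem {C : Set (Fin d → ℝ)} (hC : IsConvexCone C) {ι : Type*}
    (s : Finset ι) (x : ι → Fin d → ℝ) (hx : ∀ i ∈ s, x i ∈ C) : ∑ i ∈ s, x i ∈ C := by
  induction s using Finset.induction_on with
  | empty => simpa using hC.1
  | insert u s hu ih =>
    rw [Finset.sum_insert hu]
    exact hC.2.1 _ (hx u (by simp)) _ (ih fun i hi => hx i (by simp [hi]))

theorem IsFaceOf.mem_of_sum_mem {F C : Set (Fin d → ℝ)} (hF : IsFaceOf F C) (hC : IsConvexCone C)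
    {ι : Type*} (s : Finset ι) (x : ι → Fin d → ℝ) (hx : ∀ i ∈ s, x i ∈ C)
    (hs : ∑ i ∈ s, x i ∈ F) : ∀ i ∈ s, x i ∈ F := by
  induction s using Finset.induction_on with
  | empty => simp
  | insert u s hu ih =>
    rw [Finset.sum_insert hu] at hs
    have := hF.2.2 _ (hx u (by simp)) _
      (hC.sum_mem s x fun i hi => hx i (by simp [hi])) hs
    intro i hi
    rcases Finset.mem_insert.1 hi with rfl | hi
    exacts [this.1, ih (fun i hi => hx i (by simp [hi])) this.2 i hi]

theorem IsConvexCone.mem_of_smul_mem {C : Set (Fin d → ℝ)} (hC : IsConvexCone C) {t : ℝ}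
    (ht : 0 < t) {x : Fin d → ℝ} (hx : t • x ∈ C) : x ∈ C := by
  simpa [smul_smul, ht.ne'] using hC.2.2 _ hx t⁻¹ (inv_nonneg.2 ht.le)

/-- A linear functional that is nonnegative on `C` and vanishes on `C` exactly along `F`. -/
def Exposes (l : Dual ℝ (Fin d → ℝ)) (F C : Set (Fin d → ℝ)) : Prop :=
  ∀ c ∈ C, 0 ≤ l c ∧ (l c = 0 ↔ c ∈ F)

theorem nonneg_on_conicalHull {S : Finset (Fin d → ℝ)} {l : Dual ℝ (Fin d → ℝ)}
    (hl : ∀ v ∈ S, 0 ≤ l v) : ∀ c ∈ conicalHull S, 0 ≤ l c := by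
  rintro _ ⟨c, hc, rfl⟩
  simpa using Finset.sum_nonneg fun v hv => mul_nonneg (hc v) (hl v hv)

/-- The zero locus on a cone of a nonnegative functional is a face. -/
theorem isFaceOf_zeros {C : Set (Fin d → ℝ)} (hC : IsConvexCone C) {l : Dual ℝ (Fin d → ℝ)}
    (hl : ∀ c ∈ C, 0 ≤ l c) : IsFaceOf {c ∈ C | l c = 0} C := by
  refine ⟨⟨⟨hC.1, by simp⟩, ?_, ?_⟩, fun x hx => hx.1, ?_⟩
  · rintro x ⟨hx, hx'⟩ y ⟨hy, hy'⟩
    exact ⟨hC.2.1 x hx y hy, by simp [hx', hy']⟩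
  · rintro x ⟨hx, hx'⟩ t ht
    exact ⟨hC.2.2 x hx t ht, by simp [hx']⟩
  · rintro x hx y hy ⟨-, h⟩
    have h1 := hl x hx
    have h2 := hl y hy
    rw [map_add] at h
    exact ⟨⟨hx, by linarith⟩, hy, by linarith⟩

/-- Every face of a finitely generated cone is exposed. -/
theorem exists_exposes {S : Finset (Fin d → ℝ)} {F : Set (Fin d → ℝ)}
    (hF : IsFaceOf F (conicalHull S)) : ∃ l, Exposes l F (conicalHull S) := by
  have hC := isConvexCone_conicalHull S
  have key : ∀ v ∈ S, v ∉ F → ∃ l : Dual ℝ (Fin d → ℝ), (∀ w ∈ S, 0 ≤ l w) ∧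
      (∀ w ∈ S, w ∈ F → l w = 0) ∧ 0 < l v := by
    intro v hv hvF
    obtain ⟨l, hl, hlv⟩ := exists_dual_neg_of_notMem_cone (S.disjSum (S.filter (· ∈ F)))
      (Sum.elim id fun w => -w) (-v) (by
        rintro ⟨c, hc, h⟩
        rw [Finset.sum_disjSum] at h
        simp only [Sum.elim_inl, Sum.elim_inr, id, smul_neg, Finset.sum_neg_distrib] at h
        have h1 : v + ∑ w ∈ S, c (Sum.inl w) • w =
            ∑ w ∈ S.filter (· ∈ F), c (Sum.inr w) • w := by
          linear_combination -h
        have h2 : ∑ w ∈ S.filter (· ∈ F), c (Sum.inr w) • w ∈ F :=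
          hF.1.sum_mem _ _ fun w hw => hF.1.2.2 _ (Finset.mem_filter.1 hw).2 _ (hc _)
        rw [← h1] at h2
        exact hvF (hF.2.2 v (subset_conicalHull S hv) _ ⟨fun w => c (Sum.inl w), fun w => hc _, rfl⟩
          h2).1)
    have hl1 : ∀ w ∈ S, 0 ≤ l w := fun w hw => hl (Sum.inl w) (by simpa using hw)
    refine ⟨l, hl1, fun w hw hwF => le_antisymm ?_ (hl1 w hw), by simpa using hlv⟩
    simpa using hl (Sum.inr w) (by simpa using ⟨hw, hwF⟩)
  choose! l h1 h2 h3 using key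
  have hpos : ∀ w ∈ S, 0 ≤ (∑ v ∈ S.filter (· ∉ F), l v) w := fun w hw => by
    rw [LinearMap.sum_apply]
    exact Finset.sum_nonneg fun v hv => by
      obtain ⟨hv, hvF⟩ := Finset.mem_filter.1 hv
      exact h1 v hv hvF w hw
  have hzero : ∀ w ∈ S, (∑ v ∈ S.filter (· ∉ F), l v) w = 0 ↔ w ∈ F := fun w hw => by
    rw [LinearMap.sum_apply]
    constructor
    · intro h
      by_contra hwF
      rw [Finset.sum_eq_zero_iff_of_nonneg fun v hv => by
        obtain ⟨hv, hvF⟩ := Finset.mem_filter.1 hv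
        exact h1 v hv hvF w hw] at h
      exact (h3 w hw hwF).ne' (h w (by simp [hw, hwF]))
    · intro hwF
      refine Finset.sum_eq_zero fun v hv => ?_
      obtain ⟨hv, hvF⟩ := Finset.mem_filter.1 hv
      exact h2 v hv hvF w hw hwF
  generalize (∑ v ∈ S.filter (· ∉ F), l v) = m at hpos hzero
  refine ⟨m, fun c hc => ⟨nonneg_on_conicalHull hpos c hc, ?_⟩⟩
  obtain ⟨a, ha, rfl⟩ := hc
  have hterm : (∀ v ∈ S, m (a v • v) = 0) ↔ ∀ v ∈ S, a v • v ∈ F := by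
    refine forall₂_congr fun v hv => ?_
    rcases (ha v).eq_or_lt with h0 | h0
    · simp [← h0, hF.1.1]
    · rw [map_smul, smul_eq_mul, mul_eq_zero, or_iff_right h0.ne', hzero v hv]
      exact ⟨fun h => hF.1.2.2 _ h _ h0.le, fun h => hF.1.mem_of_smul_mem h0 h⟩
  rw [map_sum, Finset.sum_eq_zero_iff_of_nonneg fun v hv => by
    simpa using mul_nonneg (ha v) (hpos v hv), hterm]
  exact ⟨fun h => hF.1.sum_mem _ _ h, fun h => hF.mem_of_sum_mem hC S _
    (fun v hv => hC.2.2 _ (subset_conicalHull S hv) _ (ha v)) h⟩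

/-- The largest multiple of `m` that can be subtracted from `l` keeping it nonnegative. -/
theorem exists_tilt {S : Finset (Fin d → ℝ)} {m : Dual ℝ (Fin d → ℝ)} (l : Dual ℝ (Fin d → ℝ))
    (hm : ∃ v ∈ S, 0 < m v) :
    ∃ s : ℝ, (∀ v ∈ S, 0 < m v → s * m v ≤ l v) ∧ ∃ v ∈ S, 0 < m v ∧ l v = s * m v := by
  obtain ⟨v, hv, hmv⟩ := hm
  obtain ⟨w, hw, hmin⟩ := Finset.exists_min_image (S.filter (0 < m ·)) (fun v => l v / m v)
    ⟨v, by simp [hv, hmv]⟩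
  obtain ⟨hwS, hmw⟩ := Finset.mem_filter.1 hw
  refine ⟨l w / m w, fun u hu hmu => ?_, w, hwS, hmw, by field_simp⟩
  exact (le_div_iff₀ hmu).1 (hmin u (by simp [hu, hmu]))

/-- A maximal proper face. -/
def IsFacetOf (F C : Set (Fin d → ℝ)) : Prop :=
  IsFaceOf F C ∧ F ≠ C ∧ ∀ D, IsFaceOf D C → D ≠ C → F ⊆ D → D = F

theorem IsFaceOf.exists_mem_notMem {F C : Set (Fin d → ℝ)} (hF : IsFaceOf F C) (hne : F ≠ C) :
    ∃ c ∈ C, c ∉ F := by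
  by_contra! h
  exact hne (hF.2.1.antisymm h)

theorem exists_pos_of_exposes {S : Finset (Fin d → ℝ)} {F : Set (Fin d → ℝ)}
    (hF : IsFaceOf F (conicalHull S)) (hne : F ≠ conicalHull S) {l : Dual ℝ (Fin d → ℝ)}
    (hl : Exposes l F (conicalHull S)) : ∃ v ∈ S, 0 < l v := by
  by_contra! h
  obtain ⟨c, hc, hcF⟩ := hF.exists_mem_notMem hne
  have h1 := nonneg_on_conicalHull (S := S) (l := -l) (by simpa using h) c hc
  have h2 := (hl c hc).1
  rw [LinearMap.neg_apply] at h1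
  exact hcF ((hl c hc).2.1 (by linarith))

/-- Up to scaling, a facet is cut out by a single functional. -/
theorem IsFacetOf.exists_eq_smul {S : Finset (Fin d → ℝ)} {F : Set (Fin d → ℝ)}
    (hF : IsFacetOf F (conicalHull S)) {l m : Dual ℝ (Fin d → ℝ)}
    (hl : Exposes l F (conicalHull S)) (hm : ∀ c ∈ F, m c = 0) :
    ∃ s : ℝ, ∀ x ∈ Submodule.span ℝ (conicalHull S), m x = s * l x := by
  obtain ⟨s, hs, v, hv, hlv, hmv⟩ := exists_tilt m (exists_pos_of_exposes hF.1 hF.2.1 hl)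
  have hsub := subset_conicalHull S
  have hnn : ∀ c ∈ conicalHull S, 0 ≤ (m - s • l) c := by
    refine nonneg_on_conicalHull fun w hw => ?_
    rcases (hl w (hsub hw)).1.eq_or_lt with h0 | h0
    · simp [← h0, hm w ((hl w (hsub hw)).2.1 h0.symm)]
    · simpa using hs w hw h0
  have hface := isFaceOf_zeros (isConvexCone_conicalHull S) hnn
  have hall : {c ∈ conicalHull S | (m - s • l) c = 0} = conicalHull S := by
    by_contra hne
    have := hF.2.2 _ hface hne fun c hc =>
      ⟨hF.1.2.1 hc, by simp [hm c hc, (hl c (hF.1.2.1 hc)).2.2 hc]⟩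
    have hvF : v ∈ F := by
      rw [← this]
      exact ⟨hsub hv, by simp [hmv]⟩
    exact hlv.ne' ((hl v (hsub hv)).2.2 hvF)
  refine ⟨s, fun x hx => ?_⟩
  have : Submodule.span ℝ (conicalHull S) ≤ LinearMap.ker (m - s • l) := by
    rw [Submodule.span_le]
    intro c hc
    rw [← hall] at hc
    exact hc.2
  simpa [sub_eq_zero] using this hx

theorem IsFacetOf.mem_span {S : Finset (Fin d → ℝ)} {F : Set (Fin d → ℝ)}
    (hF : IsFacetOf F (conicalHull S)) {l : Dual ℝ (Fin d → ℝ)}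
    (hl : Exposes l F (conicalHull S)) {x : Fin d → ℝ}
    (hx : x ∈ Submodule.span ℝ (conicalHull S)) (hlx : l x = 0) : x ∈ Submodule.span ℝ F := by
  by_contra h
  obtain ⟨m, hmx, hm⟩ := Submodule.exists_le_ker_of_notMem h
  obtain ⟨s, hs⟩ := hF.exists_eq_smul hl (m := m) fun c hc => hm (Submodule.subset_span hc)
  exact hmx (by rw [hs x hx, hlx, mul_zero])

/-- Functionals exposing the same facet differ by a positive factor. -/
theorem IsFacetOf.exists_eq_pos_smul {S : Finset (Fin d → ℝ)} {F : Set (Fin d → ℝ)}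
    (hF : IsFacetOf F (conicalHull S)) {l m : Dual ℝ (Fin d → ℝ)}
    (hl : Exposes l F (conicalHull S)) (hm : Exposes m F (conicalHull S)) :
    ∃ s : ℝ, 0 < s ∧ ∀ x ∈ Submodule.span ℝ (conicalHull S), m x = s * l x := by
  obtain ⟨s, hs⟩ := hF.exists_eq_smul hl (m := m) fun c hc => (hm c (hF.1.2.1 hc)).2.2 hc
  refine ⟨s, ?_, hs⟩
  obtain ⟨c, hc, hcF⟩ := hF.1.exists_mem_notMem hF.2.1
  have h1 := hs c (Submodule.subset_span hc)
  have h2 : 0 < l c := (hl c hc).1.lt_of_ne' fun h => hcF ((hl c hc).2.1 h)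
  have h3 : 0 < m c := (hm c hc).1.lt_of_ne' fun h => hcF ((hm c hc).2.1 h)
  rw [h1] at h3
  exact pos_of_mul_pos_left h3 h2.le

theorem IsFaceOf.trans {G F C : Set (Fin d → ℝ)} (h1 : IsFaceOf G F) (h2 : IsFaceOf F C) :
    IsFaceOf G C := by
  refine ⟨h1.1, h1.2.1.trans h2.2.1, fun x hx y hy h => ?_⟩
  have := h2.2.2 x hx y hy (h1.2.1 h)
  exact h1.2.2 x this.1 y this.2 h

end Cones

namespace Fan

variable {d : ℕ} (Φ : Fan d) {C F G : Set (Fin d → ℝ)}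

theorem exists_gens (hC : C ∈ Φ.cones) : ∃ S : Finset (Fin d → ℝ), C = conicalHull S := by
  obtain ⟨⟨S, -, h⟩, -⟩ := Φ.pointed C hC
  exact ⟨S, h⟩

theorem isConvexCone (hC : C ∈ Φ.cones) : IsConvexCone C := by
  obtain ⟨S, rfl⟩ := Φ.exists_gens hC
  exact isConvexCone_conicalHull S

theorem isFaceOf_iff (hC : C ∈ Φ.cones) : IsFaceOf F C ↔ F ∈ Φ.cones ∧ F ⊆ C := by
  refine ⟨fun h => ⟨Φ.faces_mem C hC F h, h.2.1⟩, fun ⟨h, h'⟩ => ?_⟩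
  have := (Φ.inter_face C hC F h).1
  rwa [Set.inter_eq_self_of_subset_right h'] at this

theorem exists_exposes (hC : C ∈ Φ.cones) (hF : IsFaceOf F C) : ∃ l, Exposes l F C := by
  obtain ⟨S, rfl⟩ := Φ.exists_gens hC
  exact _root_.exists_exposes hF

theorem exists_isFacetOf (hC : C ∈ Φ.cones) (hF : IsFaceOf F C) (hne : F ≠ C) :
    ∃ G, IsFacetOf G C ∧ F ⊆ G := by
  have hfin : {D | IsFaceOf D C ∧ D ≠ C}.Finite :=
    Φ.finite.subset fun D hD => Φ.faces_mem C hC D hD.1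
  obtain ⟨G, hFG, hG⟩ := hfin.exists_le_maximal (a := F) ⟨hF, hne⟩
  exact ⟨G, ⟨hG.1.1, hG.1.2, fun D hD hD' h => (hG.2 ⟨hD, hD'⟩ h).antisymm h⟩, hFG⟩

/-- A functional that is nonnegative on a cone and negative at a point of its span can be replaced
by one that exposes a facet, without losing zeros on the cone. -/
theorem exists_facet_of_neg (hC : C ∈ Φ.cones) {y : Fin d → ℝ} (hy : y ∈ Submodule.span ℝ C)
    {l : Dual ℝ (Fin d → ℝ)} (hl : ∀ c ∈ C, 0 ≤ l c) (hly : l y < 0) :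
    ∃ F m, IsFacetOf F C ∧ Exposes m F C ∧ m y < 0 ∧ ∀ c ∈ C, l c = 0 → c ∈ F := by
  obtain ⟨S, hS⟩ := Φ.exists_gens hC
  induction hn : (S.filter (0 < l ·)).card using Nat.strong_induction_on generalizing l with
  | _ n ih =>
    have hface := isFaceOf_zeros (Φ.isConvexCone hC) hl
    have hproper : {c ∈ C | l c = 0} ≠ C := by
      intro h
      have : Submodule.span ℝ C ≤ LinearMap.ker l := by
        rw [Submodule.span_le]
        intro c hc
        rw [← h] at hc
        exact hc.2
      exact hly.ne (this hy)
    obtain ⟨F, hF, hsub⟩ := Φ.exists_isFacetOf hC hface hproper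
    obtain ⟨m, hm⟩ := Φ.exists_exposes hC hF.1
    by_cases hmy : m y < 0
    · exact ⟨F, m, hF, hm, hmy, fun c hc h => hsub ⟨hc, h⟩⟩
    push Not at hmy
    have hSC : ∀ v ∈ S, v ∈ C := fun v hv => hS ▸ subset_conicalHull S hv
    obtain ⟨s, hs, v, hv, hmv, hlv⟩ := exists_tilt l
      (exists_pos_of_exposes (hS ▸ hF.1) (hS ▸ hF.2.1) (hS ▸ hm))
    have hs0 : 0 ≤ s := by
      have := hl v (hSC v hv)
      rw [hlv] at this
      exact nonneg_of_mul_nonneg_left this hmv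
    have hzero : ∀ c ∈ C, l c = 0 → (l - s • m) c = 0 := fun c hc h => by
      simp [h, (hm c hc).2.2 (hsub ⟨hc, h⟩)]
    have hnn : ∀ c ∈ C, 0 ≤ (l - s • m) c := by
      rw [hS]
      refine nonneg_on_conicalHull fun w hw => ?_
      rcases (hm w (hSC w hw)).1.eq_or_lt with h0 | h0
      · simpa [← h0] using hl w (hSC w hw)
      · simpa using hs w hw h0
    obtain ⟨F', m', hF', hm', hmy', h⟩ := ih (S.filter (0 < (l - s • m) ·)).card (by
      rw [← hn]
      refine Finset.card_lt_card (Finset.ssubset_iff_of_subset ?_ |>.2 ⟨v, ?_, ?_⟩)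
      · intro w hw
        rw [Finset.mem_filter] at hw ⊢
        refine ⟨hw.1, (hl w (hSC w hw.1)).lt_of_ne' fun h => hw.2.ne' (hzero w (hSC w hw.1) h)⟩
      · rw [Finset.mem_filter]
        refine ⟨hv, (hl v (hSC v hv)).lt_of_ne' fun h => ?_⟩
        exact hmv.ne' ((hm v (hSC v hv)).2.2 (hsub ⟨hSC v hv, h⟩))
      · simp [hlv]) hnn (by
        have := mul_nonneg hs0 hmy
        simp only [LinearMap.sub_apply, LinearMap.smul_apply, smul_eq_mul]
        linarith) rfl
    exact ⟨F', m', hF', hm', hmy', fun c hc h0 => h c hc (hzero c hc h0)⟩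

/-- A proper face of a facet lies in a second facet. -/
theorem exists_second_facet (hC : C ∈ Φ.cones) (hF : IsFacetOf F C) (hG : IsFaceOf G F)
    (hne : G ≠ F) : ∃ F', IsFacetOf F' C ∧ F' ≠ F ∧ G ⊆ F' := by
  obtain ⟨l, hl⟩ := Φ.exists_exposes hC (hG.trans hF.1)
  obtain ⟨f, hf, hfG⟩ := hG.exists_mem_notMem hne
  have hfC := hF.1.2.1 hf
  obtain ⟨F', m, hF', hm, hmf, h⟩ := Φ.exists_facet_of_neg hC (y := -f) (l := l)
    (Submodule.neg_mem _ (Submodule.subset_span hfC)) (fun c hc => (hl c hc).1) (by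
      have : 0 < l f := (hl f hfC).1.lt_of_ne' fun h => hfG ((hl f hfC).2.1 h)
      simpa using this)
  refine ⟨F', hF', ?_, fun g hg => ?_⟩
  · rintro rfl
    simp [(hm f hfC).2.2 hf] at hmf
  · have hgC := hF.1.2.1 (hG.2.1 hg)
    exact h g hgC ((hl g hgC).2.2 hg)

/-- The fan of proper faces of a cone of a fan. -/
def boundary (C : Set (Fin d → ℝ)) (hC : C ∈ Φ.cones) : Fan d where
  cones := bdFaceSet Φ C
  finite := Φ.finite.subset fun _ h => h.1
  pointed D hD := Φ.pointed D hD.1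
  faces_mem D hD D' h := ⟨Φ.faces_mem D hD.1 D' h, h.2.1.trans hD.2.1, by
    rintro rfl
    exact hD.2.2 (hD.2.1.antisymm h.2.1)⟩
  inter_face D hD D' hD' := Φ.inter_face D hD.1 D' hD'.1

theorem isFacet_boundary_iff (hC : C ∈ Φ.cones) :
    IsFacet (Φ.boundary C hC) F ↔ IsFacetOf F C := by
  simp only [IsFacet, IsFacetOf, Φ.isFaceOf_iff hC]
  constructor
  · rintro ⟨⟨h1, h2, h3⟩, h⟩
    exact ⟨⟨h1, h2⟩, h3, fun D hD hne hsub => h D ⟨hD.1, hD.2, hne⟩ hsub⟩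
  · rintro ⟨⟨h1, h2⟩, h3, h⟩
    exact ⟨⟨h1, h2, h3⟩, fun D hD hsub => h D ⟨hD.1, hD.2.1⟩ hD.2.2 hsub⟩

theorem faceSet_boundary (hC : C ∈ Φ.cones) (hF : F ⊆ C) (hne : F ≠ C) :
    faceSet (Φ.boundary C hC) F = faceSet Φ F := by
  ext D
  refine ⟨fun h => ⟨h.1.1, h.2⟩, fun h => ⟨⟨h.1, h.2.trans hF, ?_⟩, h.2⟩⟩
  rintro rfl
  exact hne (hF.antisymm h.2)

theorem zero_mem_of_nonempty (h : C ∈ Φ.cones) : ({0} : Set (Fin d → ℝ)) ∈ Φ.cones := by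
  refine Φ.faces_mem C h _ ⟨⟨rfl, ?_, ?_⟩, ?_, ?_⟩
  · rintro x rfl y rfl; simp
  · rintro x rfl t -; simp
  · rintro x rfl; exact (Φ.isConvexCone h).1
  · intro x hx y hy hxy
    have hxy : x + y = 0 := hxy
    have hx0 : x = 0 := (Φ.pointed C h).2 x hx (by rwa [neg_eq_of_add_eq_zero_right hxy])
    subst hx0
    simpa using hxy

/-- Positive combinations of the generators give a point on no proper face. -/
theorem exists_pos_point (hC : C ∈ Φ.cones) :
    ∃ x ∈ C, ∀ F, IsFaceOf F C → x ∈ F → F = C := by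
  obtain ⟨S, rfl⟩ := Φ.exists_gens hC
  refine ⟨∑ v ∈ S, v, (Φ.isConvexCone hC).sum_mem _ _ fun v hv => subset_conicalHull S hv,
    fun F hF h => hF.2.1.antisymm ?_⟩
  rintro _ ⟨c, hc, rfl⟩
  refine hF.1.sum_mem _ _ fun v hv => hF.1.2.2 _ ?_ _ (hc v)
  exact hF.mem_of_sum_mem (Φ.isConvexCone hC) S id (fun v hv => subset_conicalHull S hv) h v hv

/-- A point of the span, positive for given functionals exposing the facets, that separates the
ratios of these functionals to their values at `y`. -/
theorem exists_generic_point (hC : C ∈ Φ.cones) (l : Set (Fin d → ℝ) → Dual ℝ (Fin d → ℝ))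
    (hl : ∀ F, IsFacetOf F C → Exposes (l F) F C) (y : Fin d → ℝ)
    (hy : ∀ F, IsFacetOf F C → l F y ≠ 0) :
    ∃ x ∈ Submodule.span ℝ C, (∀ F, IsFacetOf F C → 0 < l F x) ∧
      ∀ F G, IsFacetOf F C → IsFacetOf G C → F ≠ G → l F y * l G x ≠ l G y * l F x := by
  obtain ⟨x, hxC, hx⟩ := Φ.exists_pos_point hC
  have hfin : {F | IsFacetOf F C}.Finite :=
    Φ.finite.subset fun D hD => Φ.faces_mem C hC D hD.1
  let T : Set (Set (Fin d → ℝ) × Set (Fin d → ℝ)) :=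
    {p | IsFacetOf p.1 C ∧ IsFacetOf p.2 C ∧ p.1 ≠ p.2}
  have hT : T.Finite := (hfin.prod hfin).subset fun p hp => ⟨hp.1, hp.2.1⟩
  let r : Set (Fin d → ℝ) × Set (Fin d → ℝ) → Dual ℝ (Fin d → ℝ) :=
    fun p => l p.1 y • l p.2 - l p.2 y • l p.1
  let W := Submodule.span ℝ C
  obtain ⟨z, hz, hzT⟩ : ∃ z ∈ W, ∀ p ∈ T, r p z ≠ 0 := by
    let s : Finset (Subspace ℝ W) := hT.toFinset.image fun p => LinearMap.ker ((r p) ∘ₗ W.subtype)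
    have hs : (⊤ : Subspace ℝ W) ∉ s := by
      intro h
      obtain ⟨p, hp, hker⟩ := Finset.mem_image.1 h
      rw [Set.Finite.mem_toFinset] at hp
      obtain ⟨h1, h2, hne⟩ := hp
      obtain ⟨f, hf, hfG⟩ : ∃ f ∈ p.1, f ∉ p.2 := by
        by_contra! hsub
        exact hne (h1.2.2 _ h2.1 h2.2.1 hsub).symm
      have hfC := h1.1.2.1 hf
      have hmem : (⟨f, Submodule.subset_span hfC⟩ : W) ∈ LinearMap.ker ((r p) ∘ₗ W.subtype) := by
        rw [hker]; trivial
      have h3 : r p f = 0 := hmem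
      simp only [r, LinearMap.sub_apply, LinearMap.smul_apply, smul_eq_mul,
        (hl _ h1 f hfC).2.2 hf, mul_zero, sub_zero, mul_eq_zero] at h3
      exact h3.elim (hy _ h1) fun h => hfG ((hl _ h2 f hfC).2.1 h)
    have := Subspace.biUnion_ne_univ_of_top_notMem hs
    obtain ⟨z, hz⟩ := (Set.ne_univ_iff_exists_notMem _).1 this
    refine ⟨z, z.2, fun p hp h0 => hz ?_⟩
    refine Set.mem_biUnion (x := LinearMap.ker ((r p) ∘ₗ W.subtype)) ?_ h0
    exact Finset.mem_image.2 ⟨p, hT.mem_toFinset.2 hp, rfl⟩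
  have hcont : ∀ m : Dual ℝ (Fin d → ℝ), Filter.Tendsto (fun e : ℝ => m (x + e • z))
      (nhdsWithin 0 (Set.Ioi 0)) (nhds (m x)) := fun m => by
    have : Filter.Tendsto (fun e : ℝ => m x + e * m z) (nhds 0) (nhds (m x + 0 * m z)) :=
      (by fun_prop : Continuous fun e : ℝ => m x + e * m z).tendsto 0
    simp only [map_add, map_smul, smul_eq_mul]
    simpa using this.mono_left nhdsWithin_le_nhds
  have ev1 : ∀ᶠ e : ℝ in nhdsWithin 0 (Set.Ioi 0), ∀ F ∈ {F | IsFacetOf F C},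
      0 < l F (x + e • z) := by
    rw [Filter.eventually_all_finite hfin]
    intro F hF
    refine (hcont (l F)).eventually_const_lt ((hl F hF x hxC).1.lt_of_ne' fun h => ?_)
    exact hF.2.1 (hx F hF.1 ((hl F hF x hxC).2.1 h))
  have ev2 : ∀ᶠ e : ℝ in nhdsWithin 0 (Set.Ioi 0), ∀ p ∈ T, r p (x + e • z) ≠ 0 := by
    rw [Filter.eventually_all_finite hT]
    intro p hp
    by_cases h0 : r p x = 0
    · filter_upwards [self_mem_nhdsWithin] with e he
      have he : 0 < e := he
      simp [h0, he.ne', hzT p hp]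
    · exact (hcont (r p)).eventually_ne h0
  obtain ⟨e, h1, h2⟩ := (ev1.and ev2).exists
  refine ⟨x + e • z, W.add_mem (Submodule.subset_span hxC) (W.smul_mem _ hz), h1,
    fun F G hF hG hne h => h2 (F, G) ⟨hF, hG, hne⟩ ?_⟩
  simp only [r, LinearMap.sub_apply, LinearMap.smul_apply, smul_eq_mul]
  exact sub_eq_zero.2 h

end Fan

/-! ### Line shellings -/

/-- A finite set can be listed in strictly increasing order of an injective real function. -/
theorem exists_list_strictMono {α : Type*} {s : Set α} (hs : s.Finite) (f : α → ℝ)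
    (hf : Set.InjOn f s) (a : α) :
    ∃ L : List α, L.Nodup ∧ {x | x ∈ L} = s ∧
      ∀ i j, i < j → j < L.length → f (L.getD i a) < f (L.getD j a) := by
  let r : α → α → Prop := fun x y => f x ≤ f y
  have : Std.Total r := ⟨fun x y => le_total (f x) (f y)⟩
  have : IsTrans α r := ⟨fun x y z => le_trans⟩
  let L := hs.toFinset.toList.insertionSort r
  have hmem : ∀ x, x ∈ L ↔ x ∈ s := fun x => by simp [L]
  have hnd : L.Nodup := (List.perm_insertionSort r _).nodup_iff.2 (Finset.nodup_toList _)
  refine ⟨L, hnd, Set.ext hmem, fun i j hij hj => ?_⟩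
  have hi : i < L.length := hij.trans hj
  rw [List.getD_eq_getElem _ _ hi, List.getD_eq_getElem _ _ hj]
  refine lt_of_le_of_ne
    (List.pairwise_iff_getElem.1 (List.pairwise_insertionSort r _) i j hi hj hij) fun h => ?_
  have := hf ((hmem _).1 (List.getElem_mem hi)) ((hmem _).1 (List.getElem_mem hj)) h
  exact hij.ne ((hnd.getElem_inj_iff).1 this)

/-- The negative values of an increasing list form an initial segment. -/
theorem exists_initial_segment {α : Type*} (L : List α) (f : α → ℝ) (a : α)
    (hL : ∀ i j, i < j → j < L.length → f (L.getD i a) < f (L.getD j a)) :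
    ∃ r ≤ L.length, ∀ i < L.length, (i < r ↔ f (L.getD i a) < 0) := by
  have hex : ∃ r, r = L.length ∨ 0 ≤ f (L.getD r a) := ⟨_, Or.inl rfl⟩
  refine ⟨Nat.find hex, Nat.find_min' hex (Or.inl rfl), fun i hi => ⟨fun h => ?_, fun h => ?_⟩⟩
  · have := Nat.find_min hex h
    push Not at this
    exact this.2
  · by_contra! hle
    rcases Nat.find_spec hex with h1 | h1
    · exact (h1 ▸ hle).not_gt hi
    · rcases hle.eq_or_lt with h2 | h2
      · rw [h2] at h1
        exact h1.not_gt h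
      · exact (h1.trans_lt (hL _ _ h2 hi)).not_gt h

namespace Fan

variable {d : ℕ} (Φ : Fan d) {C F G : Set (Fin d → ℝ)}

theorem dim_eq_zero_of_isEmpty (h : Φ.cones = ∅) : Φ.dim = 0 := by
  simp [Fan.dim, h]

theorem _root_.Exposes.neg_iff {S : Finset (Fin d → ℝ)} (hS : C = conicalHull S)
    (hF : IsFacetOf F C) {l m : Dual ℝ (Fin d → ℝ)} (hl : Exposes l F C) (hm : Exposes m F C)
    {y : Fin d → ℝ} (hy : y ∈ Submodule.span ℝ C) : m y < 0 ↔ l y < 0 := by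
  subst hS
  obtain ⟨s, hs, h⟩ := hF.exists_eq_pos_smul hl hm
  rw [h y hy]
  exact smul_neg_iff_of_pos_left hs

theorem ncard_faceSet_lt (hF : F ⊆ C) (hne : F ≠ C) (hC : C ∈ Φ.cones) :
    (faceSet Φ F).ncard < (faceSet Φ C).ncard := by
  refine Set.ncard_lt_ncard ⟨fun D hD => ⟨hD.1, hD.2.trans hF⟩, fun h => ?_⟩
    (Φ.finite.subset fun D hD => hD.1)
  exact hne (hF.antisymm (h ⟨hC, subset_rfl⟩).2)

/-- Near a facet `F`, the crossing point `y - c • x` of the line through `x` and `y` sees the facets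
of `F` cut out by those facets of the cone that the line crosses earlier. -/
theorem exists_crossing_facet (hC : C ∈ Φ.cones) {l : Set (Fin d → ℝ) → Dual ℝ (Fin d → ℝ)}
    (hl : ∀ F, IsFacetOf F C → Exposes (l F) F C) {x y : Fin d → ℝ}
    (hlx : ∀ F, IsFacetOf F C → 0 < l F x) (hF : IsFacetOf F C)
    (hspan : y - (l F y / l F x) • x ∈ Submodule.span ℝ F) (hG : IsFacetOf G F)
    {m : Dual ℝ (Fin d → ℝ)} (hm : Exposes m G F) :
    ∃ F', IsFacetOf F' C ∧ F' ≠ F ∧ G ⊆ F' ∧ ∃ s > 0,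
      m (y - (l F y / l F x) • x) = s * (l F' y / l F' x - l F y / l F x) := by
  obtain ⟨F', hF', hne, hGF'⟩ := Φ.exists_second_facet hC hF hG.1 hG.2.1
  refine ⟨F', hF', hne, hGF', ?_⟩
  have hFΦ : F ∈ Φ.cones := Φ.faces_mem C hC F hF.1
  have hF'Φ : F' ∈ Φ.cones := Φ.faces_mem C hC F' hF'.1
  have hinter : F ∩ F' = G := by
    refine hG.2.2 _ (Φ.inter_face F hFΦ F' hF'Φ).1 (fun h => ?_) fun g hg => ⟨hG.1.2.1 hg, hGF' hg⟩
    exact hne (hF.2.2 F' hF'.1 hF'.2.1 (Set.inter_eq_left.1 h))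
  have hlG : Exposes (l F') G F := fun c hc => by
    have := hl F' hF' c (hF.1.2.1 hc)
    refine ⟨this.1, this.2.trans ?_⟩
    rw [← hinter]
    exact ⟨fun h => ⟨hc, h⟩, fun h => h.2⟩
  obtain ⟨S, hS⟩ := Φ.exists_gens hFΦ
  subst hS
  obtain ⟨s, hs, h⟩ := hG.exists_eq_pos_smul hlG hm
  have h1 := hlx F' hF'
  refine ⟨s * l F' x, mul_pos hs h1, ?_⟩
  rw [h _ hspan, map_sub, map_smul, smul_eq_mul]
  field_simp

/-- The boundary of a cone is shellable, starting with the facets visible from a generic point of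
the span of the cone. -/
theorem exists_shelling_boundary (n : ℕ) : ∀ (Φ : Fan d) (C : Set (Fin d → ℝ)) (hC : C ∈ Φ.cones),
    (faceSet Φ C).ncard ≤ n → ∀ y ∈ Submodule.span ℝ C,
    (∀ F l, IsFacetOf F C → Exposes l F C → l y ≠ 0) →
    ∃ D : List (Set (Fin d → ℝ)), IsShellingAux n (Φ.boundary C hC) D ∧ ∃ r ≤ D.length,
      ∀ i < D.length, (i < r ↔ ∀ l, Exposes l (D.getD i ∅) C → l y < 0) := by
  induction n with
  | zero =>
    intro Φ C hC hcard
    have : (faceSet Φ C).ncard ≠ 0 :=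
      Set.ncard_ne_zero_of_mem (a := C) ⟨hC, subset_rfl⟩ (Φ.finite.subset fun D hD => hD.1)
    omega
  | succ n ih =>
    intro Φ C hC hcard y hy hgen
    have hex : ∀ F, ∃ l, IsFacetOf F C → Exposes l F C := fun F => by
      by_cases hF : IsFacetOf F C
      · obtain ⟨l, hl⟩ := Φ.exists_exposes hC hF.1
        exact ⟨l, fun _ => hl⟩
      · exact ⟨0, fun h => (hF h).elim⟩
    choose l hl using hex
    obtain ⟨x, hx, hlx, hxy⟩ := Φ.exists_generic_point hC l hl y fun F hF => hgen F _ hF (hl F hF)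
    let c : Set (Fin d → ℝ) → ℝ := fun F => l F y / l F x
    have hinj : Set.InjOn c {F | IsFacetOf F C} := by
      intro F hF G hG h
      by_contra hne
      exact hxy F G hF hG hne ((div_eq_div_iff (hlx F hF).ne' (hlx G hG).ne').1 h)
    obtain ⟨L, hnd, hmem, hmono⟩ := exists_list_strictMono
      (Φ.finite.subset fun D (hD : IsFacetOf D C) => Φ.faces_mem C hC D hD.1) c hinj ∅
    have hfacet : ∀ i < L.length, IsFacetOf (L.getD i ∅) C := fun i hi => by
      rw [List.getD_eq_getElem _ _ hi]
      exact hmem.subset (List.getElem_mem hi)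
    obtain ⟨S, hS⟩ := Φ.exists_gens hC
    obtain ⟨r, hr, hrL⟩ := exists_initial_segment L c ∅ hmono
    refine ⟨L, ?_, r, hr, fun i hi => (hrL i hi).trans ?_⟩
    swap
    · have hF := hfacet i hi
      have h1 : c (L.getD i ∅) < 0 ↔ l (L.getD i ∅) y < 0 := by
        simp only [c]
        rw [div_lt_iff₀ (hlx _ hF), zero_mul]
      rw [h1]
      exact ⟨fun h m hm => (Exposes.neg_iff hS hF (hl _ hF) hm hy).2 h, fun h => h _ (hl _ hF)⟩
    have hΨ : ∀ F, IsFacetOf F C → F ∈ (Φ.boundary C hC).cones := fun F hF =>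
      ((Φ.isFacet_boundary_iff hC).2 hF).1
    have hspan : ∀ F, IsFacetOf F C → y - c F • x ∈ Submodule.span ℝ F := fun F hF => by
      subst hS
      refine hF.mem_span (hl F hF) (Submodule.sub_mem _ hy (Submodule.smul_mem _ _ hx)) ?_
      have := (hlx F hF).ne'
      simp only [c, map_sub, map_smul, smul_eq_mul]
      field_simp
      ring
    have hrec : ∀ F (hF : IsFacetOf F C), ∃ D : List (Set (Fin d → ℝ)),
        IsShellingAux n ((Φ.boundary C hC).boundary F (hΨ F hF)) D ∧ ∃ r ≤ D.length,
        ∀ i < D.length, (i < r ↔ ∀ l, Exposes l (D.getD i ∅) F → l (y - c F • x) < 0) := by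
      intro F hF
      refine ih (Φ.boundary C hC) F (hΨ F hF) ?_ _ (hspan F hF) ?_
      · rw [Φ.faceSet_boundary hC hF.1.2.1 hF.2.1]
        have := Φ.ncard_faceSet_lt hF.1.2.1 hF.2.1 hC
        omega
      · intro G m hG hm
        obtain ⟨F', hF', hne, -, s, hs, h⟩ :=
          Φ.exists_crossing_facet hC hl hlx hF (hspan F hF) hG hm
        exact fun h0 => mul_ne_zero hs.ne'
          (sub_ne_zero.2 fun h' => hne (hinj hF' hF h')) (h.symm.trans h0)
    refine ⟨hnd, by rw [hmem]; ext F; exact (Φ.isFacet_boundary_iff hC).symm, ?_⟩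
    by_cases hdim : (Φ.boundary C hC).dim = 0
    · exact Or.inl hdim
    refine Or.inr ⟨?_, fun j hj hjL => ?_⟩
    · have hL : 0 < L.length := by
        by_contra! h0
        have hLnil : L = [] := List.eq_nil_of_length_eq_zero (by omega)
        refine hdim (dim_eq_zero_of_isEmpty _ (Set.eq_empty_of_forall_notMem fun F hF => ?_))
        obtain ⟨G, hG, -⟩ := Φ.exists_isFacetOf hC ((Φ.isFaceOf_iff hC).2 ⟨hF.1, hF.2.1⟩) hF.2.2
        have : G ∈ L := hmem.superset hG
        simp [hLnil] at this
      obtain ⟨D, hD, -⟩ := hrec _ (hfacet 0 hL)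
      exact ⟨_, rfl, D, hD⟩
    · have hF := hfacet j hjL
      have hidx : ∀ i ∈ Finset.range j, i < j ∧ i < L.length := fun i hi => by
        have := Finset.mem_range.1 hi
        exact ⟨this, this.trans hjL⟩
      have hlt : ∀ i < j, c (L.getD i ∅) < c (L.getD j ∅) := fun i hi => hmono i j hi hjL
      have hge : ∀ i < L.length, c (L.getD i ∅) < c (L.getD j ∅) → i < j := fun i hi h => by
        by_contra! hji
        rcases hji.eq_or_lt with rfl | h'
        exacts [h.false, (h.trans (hmono j i h' hi)).false]
      generalize L.getD j ∅ = F at hF hlt hge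
      obtain ⟨D, hD, r, hr, hrD⟩ := hrec F hF
      refine ⟨_, rfl, D, hD, r, ?_⟩
      have hDmem : ∀ G, G ∈ D ↔ IsFacetOf G F := fun G => by
        have h1 : {E | E ∈ D} = {E | IsFacet ((Φ.boundary C hC).boundary F (hΨ F hF)) E} := by
          cases n <;> exact hD.2.1
        exact (Set.ext_iff.1 h1 G).trans (isFacet_boundary_iff _ _)
      have hne : (⋃ i ∈ Finset.range j, (faceSet (Φ.boundary C hC) (L.getD i ∅) ∩
          faceSet (Φ.boundary C hC) F)) ≠ ∅ := by
        refine Set.Nonempty.ne_empty ⟨{0}, Set.mem_biUnion (Finset.mem_range.2 hj) ?_⟩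
        have h0 := (Φ.boundary C hC).zero_mem_of_nonempty (hΨ F hF)
        refine ⟨⟨h0, ?_⟩, h0, ?_⟩
        · simpa using (hfacet 0 (hj.trans hjL)).1.1.1
        · simpa using hF.1.1.1
      have heq : (⋃ i ∈ Finset.range j, (faceSet (Φ.boundary C hC) (L.getD i ∅) ∩
          faceSet (Φ.boundary C hC) F)) = ⋃ k ∈ Finset.range r,
            faceSet ((Φ.boundary C hC).boundary F (hΨ F hF)) (D.getD k ∅) := by
        ext H
        simp only [Set.mem_iUnion, exists_prop]
        constructor
        · rintro ⟨i, hi, ⟨hHΨ, hHi⟩, -, hHF⟩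
          obtain ⟨hij, hiL⟩ := hidx i hi
          have hFi := hfacet i hiL
          have hci := hlt i hij
          generalize L.getD i ∅ = E at hFi hci hHi
          have hEx := hlx E hFi
          obtain ⟨G, m, hG, hm, hmy, hz⟩ := Φ.exists_facet_of_neg (hΨ F hF).1 (hspan F hF)
            (l := l E) (fun f hf => (hl E hFi f (hF.1.2.1 hf)).1) (by
              have h2 : l E (y - c F • x) = l E x * (c E - c F) := by
                simp only [c, map_sub, map_smul, smul_eq_mul]
                field_simp
              rw [h2]
              exact mul_neg_of_pos_of_neg hEx (sub_neg.2 hci))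
          obtain ⟨k, hk, rfl⟩ := List.mem_iff_getElem.1 ((hDmem G).2 hG)
          obtain ⟨T, hT⟩ := Φ.exists_gens (hΨ F hF).1
          refine ⟨k, ?_, ⟨hHΨ, hHF, ?_⟩, ?_⟩
          · rw [Finset.mem_range, hrD k hk, List.getD_eq_getElem _ _ hk]
            exact fun m' hm' => (Exposes.neg_iff hT hG hm hm' (hspan F hF)).2 hmy
          · rintro rfl
            exact hci.ne (by rw [hF.2.2 E hFi.1 hFi.2.1 hHi])
          · rw [List.getD_eq_getElem _ _ hk]
            exact fun h hh => hz h (hHF hh) ((hl E hFi h (hF.1.2.1 (hHF hh))).2.2 (hHi hh))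
        · rintro ⟨k, hk, ⟨hHΨ, hHF, -⟩, hHG⟩
          rw [Finset.mem_range] at hk
          have hkD := hk.trans_le hr
          have hvis := (hrD k hkD).1 hk
          have hG : IsFacetOf (D.getD k ∅) F := by
            rw [List.getD_eq_getElem _ _ hkD]
            exact (hDmem _).1 (List.getElem_mem hkD)
          generalize D.getD k ∅ = G at hG hvis hHG
          obtain ⟨m, hm⟩ := Φ.exists_exposes (hΨ F hF).1 hG.1
          obtain ⟨E, hE, -, hGE, s, hs, h⟩ :=
            Φ.exists_crossing_facet hC hl hlx hF (hspan F hF) hG hm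
          have hcE : c E < c F := by
            have h1 := hvis m hm
            have h2 : s * (c E - c F) < 0 := h ▸ h1
            exact sub_neg.1 ((smul_neg_iff_of_pos_left hs).1 h2)
          obtain ⟨i, hi, rfl⟩ := List.mem_iff_getElem.1 (hmem.superset hE)
          refine ⟨i, ?_, ⟨hHΨ, ?_⟩, hHΨ, hHF⟩
          · rw [Finset.mem_range]
            exact hge i hi (by rwa [List.getD_eq_getElem _ _ hi])
          · rw [List.getD_eq_getElem _ _ hi]
            exact hHG.trans hGE
      refine ⟨?_, hr, hne, heq⟩
      by_contra! h0
      obtain rfl : r = 0 := by omega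
      rw [heq] at hne
      simp at hne

/-- The boundary of a cone has a shelling starting with the facets that miss a given point. -/
theorem exists_shelling_boundary_notMem (hC : C ∈ Φ.cones) {n : ℕ}
    (hn : (faceSet Φ C).ncard ≤ n) {g : Fin d → ℝ} (hg : g ∈ C) :
    ∃ D : List (Set (Fin d → ℝ)), IsShellingAux n (Φ.boundary C hC) D ∧ ∃ r ≤ D.length,
      ∀ i < D.length, (i < r ↔ g ∉ D.getD i ∅) := by
  obtain ⟨x, hxC, hx⟩ := Φ.exists_pos_point hC
  have hfin : {F | IsFacetOf F C}.Finite :=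
    Φ.finite.subset fun D hD => Φ.faces_mem C hC D hD.1
  have hpos : ∀ F l, IsFacetOf F C → Exposes l F C → 0 < l x := fun F l hF hl =>
    (hl x hxC).1.lt_of_ne' fun h => hF.2.1 (hx F hF.1 ((hl x hxC).2.1 h))
  have ev : ∀ᶠ e : ℝ in nhdsWithin 0 (Set.Ioi 0), ∀ F ∈ {F | IsFacetOf F C},
      ∀ l, Exposes l F C → g ∉ F → e * l x < l g := by
    rw [Filter.eventually_all_finite hfin]
    intro F hF
    by_cases hgF : g ∈ F
    · simp [hgF]
    obtain ⟨l, hl⟩ := Φ.exists_exposes hC hF.1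
    have hlg : 0 < l g := (hl g hg).1.lt_of_ne' fun h => hgF ((hl g hg).2.1 h)
    have hcont : Filter.Tendsto (fun e : ℝ => e * l x) (nhdsWithin 0 (Set.Ioi 0)) (nhds 0) := by
      have : Filter.Tendsto (fun e : ℝ => e * l x) (nhds 0) (nhds (0 * l x)) :=
        (by fun_prop : Continuous fun e : ℝ => e * l x).tendsto 0
      simpa using this.mono_left nhdsWithin_le_nhds
    filter_upwards [hcont.eventually_lt_const hlg] with e he m hm _
    obtain ⟨S, rfl⟩ := Φ.exists_gens hC
    obtain ⟨s, hs, h⟩ := hF.exists_eq_pos_smul hl hm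
    rw [h x (Submodule.subset_span hxC), h g (Submodule.subset_span hg)]
    nlinarith
  obtain ⟨e, he, he0⟩ := (ev.and self_mem_nhdsWithin).exists
  have he0 : 0 < e := he0
  have hsign : ∀ F l, IsFacetOf F C → Exposes l F C →
      (g ∈ F → 0 < l (e • x - g)) ∧ (g ∉ F → l (e • x - g) < 0) := by
    intro F l hF hl
    simp only [map_sub, map_smul, smul_eq_mul, sub_neg]
    refine ⟨fun h => ?_, he F hF l hl⟩
    rw [(hl g hg).2.2 h, sub_zero]
    exact mul_pos he0 (hpos F l hF hl)
  obtain ⟨D, hD, r, hr, h⟩ := exists_shelling_boundary n Φ C hC hn (e • x - g)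
    (Submodule.sub_mem _ (Submodule.smul_mem _ _ (Submodule.subset_span hxC))
      (Submodule.subset_span hg)) fun F l hF hl => by
        by_cases hgF : g ∈ F
        exacts [((hsign F l hF hl).1 hgF).ne', ((hsign F l hF hl).2 hgF).ne]
  refine ⟨D, hD, r, hr, fun i hi => (h i hi).trans ?_⟩
  have hF : IsFacetOf (D.getD i ∅) C := by
    have h1 : {E | E ∈ D} = {E | IsFacet (Φ.boundary C hC) E} := by
      cases n <;> exact hD.2.1
    rw [List.getD_eq_getElem _ _ hi]
    exact (Φ.isFacet_boundary_iff hC).1 (h1.subset (List.getElem_mem hi))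
  obtain ⟨l, hl⟩ := Φ.exists_exposes hC hF.1
  exact ⟨fun h hgF => ((hsign _ l hF hl).1 hgF).not_gt (h l hl),
    fun hgF m hm => (hsign _ m hF hm).2 hgF⟩

/-- An ordering of the facets in which the new faces of every facet form a star is a shelling. -/
theorem isShelling_of_star {L : List (Set (Fin d → ℝ))} (hnd : L.Nodup)
    (hmem : {C | C ∈ L} = {C | IsFacet Φ C})
    (hstar : ∀ j, 0 < j → j < L.length → ∃ g ∈ L.getD j ∅,
      {D ∈ faceSet Φ (L.getD j ∅) | g ∈ D} =
        faceSet Φ (L.getD j ∅) \ (⋃ i ∈ Finset.range j, faceSet Φ (L.getD i ∅))) :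
    IsShelling Φ L := by
  refine ⟨Φ.cones.ncard + 1, hnd, hmem, ?_⟩
  by_cases hdim : Φ.dim = 0
  · exact Or.inl hdim
  have hfacet : ∀ i < L.length, IsFacet Φ (L.getD i ∅) := fun i hi => by
    rw [List.getD_eq_getElem _ _ hi]
    exact hmem.subset (List.getElem_mem hi)
  have hcard : ∀ C, (faceSet Φ C).ncard ≤ Φ.cones.ncard := fun C =>
    Set.ncard_le_ncard (fun D hD => hD.1) Φ.finite
  refine Or.inr ⟨?_, fun j hj hjL => ?_⟩
  · have hL : 0 < L.length := by
      by_contra! h0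
      have hLnil : L = [] := List.eq_nil_of_length_eq_zero (by omega)
      refine hdim (Φ.dim_eq_zero_of_isEmpty (Set.eq_empty_of_forall_notMem fun F hF => ?_))
      obtain ⟨G, -, hG⟩ := Φ.finite.exists_le_maximal hF
      have : G ∈ L := hmem.superset ⟨hG.1, fun D hD h => (hG.2 hD h).antisymm h⟩
      simp [hLnil] at this
    have hC := (hfacet 0 hL).1
    obtain ⟨D, hD, -⟩ := Φ.exists_shelling_boundary_notMem hC (hcard _) (Φ.isConvexCone hC).1
    exact ⟨_, rfl, D, hD⟩
  · have hC := (hfacet j hjL).1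
    obtain ⟨g, hg, hgstar⟩ := hstar j hj hjL
    have h0 : ({0} : Set (Fin d → ℝ)) ∈ Φ.cones := Φ.zero_mem_of_nonempty hC
    have h0mem : ∀ i < L.length, ({0} : Set (Fin d → ℝ)) ∈ faceSet Φ (L.getD i ∅) := fun i hi =>
      ⟨h0, by simpa using (Φ.isConvexCone (hfacet i hi).1).1⟩
    have h0j := h0mem j hjL
    generalize L.getD j ∅ = C at hC hg hgstar h0j
    obtain ⟨D, hD, r, hr, hrD⟩ := Φ.exists_shelling_boundary_notMem hC (hcard _) hg
    have hDmem : ∀ G, G ∈ D ↔ IsFacetOf G C := fun G => by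
      have h1 : {E | E ∈ D} = {E | IsFacet (Φ.boundary C hC) E} := by
        cases h : Φ.cones.ncard <;> rw [h] at hD <;> exact hD.2.1
      exact (Set.ext_iff.1 h1 G).trans (isFacet_boundary_iff _ _)
    have hold : ∀ H ∈ faceSet Φ C, g ∉ H ↔ ∃ i ∈ Finset.range j, H ∈ faceSet Φ (L.getD i ∅) := by
      intro H hH
      have := Set.ext_iff.1 hgstar H
      simp only [Set.mem_ofPred_eq, hH, true_and, Set.mem_sdiff, Set.mem_iUnion, exists_prop] at this
      rw [this, not_not]
    have hne : (⋃ i ∈ Finset.range j, (faceSet Φ (L.getD i ∅) ∩ faceSet Φ C)) ≠ ∅ :=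
      Set.Nonempty.ne_empty ⟨{0}, Set.mem_biUnion (Finset.mem_range.2 hj)
        ⟨h0mem 0 (hj.trans hjL), h0j⟩⟩
    have heq : (⋃ i ∈ Finset.range j, (faceSet Φ (L.getD i ∅) ∩ faceSet Φ C)) =
        ⋃ k ∈ Finset.range r, faceSet (Φ.boundary C hC) (D.getD k ∅) := by
      ext H
      simp only [Set.mem_iUnion, exists_prop]
      constructor
      · rintro ⟨i, hi, hHi, hHC⟩
        have hgH := (hold H hHC).2 ⟨i, hi, hHi⟩
        have hface := (Φ.isFaceOf_iff hC).2 hHC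
        obtain ⟨l, hl⟩ := Φ.exists_exposes hC hface
        have hlg : 0 < l g := (hl g hg).1.lt_of_ne' fun h => hgH ((hl g hg).2.1 h)
        obtain ⟨G, m, hG, hm, hmg, hz⟩ := Φ.exists_facet_of_neg hC (y := -g) (l := l)
          (Submodule.neg_mem _ (Submodule.subset_span hg)) (fun c hc => (hl c hc).1)
          (by simpa using hlg)
        have hgG : g ∉ G := fun h => by
          simp [(hm g hg).2.2 h] at hmg
        obtain ⟨k, hk, rfl⟩ := List.mem_iff_getElem.1 ((hDmem G).2 hG)
        refine ⟨k, ?_, ⟨hHC.1, hHC.2, ?_⟩, ?_⟩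
        · rw [Finset.mem_range, hrD k hk, List.getD_eq_getElem _ _ hk]
          exact hgG
        · rintro rfl
          exact hgH hg
        · rw [List.getD_eq_getElem _ _ hk]
          exact fun h hh => hz h (hHC.2 hh) ((hl h (hHC.2 hh)).2.2 hh)
      · rintro ⟨k, hk, ⟨hHΦ, hHC, -⟩, hHG⟩
        rw [Finset.mem_range] at hk
        have hkD := hk.trans_le hr
        have hgG := (hrD k hkD).1 hk
        have hG : IsFacetOf (D.getD k ∅) C := by
          rw [List.getD_eq_getElem _ _ hkD]
          exact (hDmem _).1 (List.getElem_mem hkD)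
        obtain ⟨i, hi, hGi⟩ := (hold _ ((Φ.isFaceOf_iff hC).1 hG.1)).1 hgG
        exact ⟨i, hi, ⟨hHΦ, hHG.trans hGi.2⟩, hHΦ, hHC⟩
    refine ⟨Φ.boundary C hC, rfl, D, hD, r, ?_, hr, hne, heq⟩
    by_contra! h0
    obtain rfl : r = 0 := by omega
    rw [heq] at hne
    simp at hne

end Fan

/-! ### Relative interiors and lattice points -/

section Relint

variable {d : ℕ}

theorem mem_relint_iff {F : Set (Fin d → ℝ)} {a : Fin d → ℝ} :
    a ∈ relint F ↔ a ∈ affineSpan ℝ F ∧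
      ∃ e > 0, ∀ x ∈ affineSpan ℝ F, dist x a < e → x ∈ F := by
  rw [relint, mem_intrinsicInterior]
  constructor
  · rintro ⟨y, hy, rfl⟩
    obtain ⟨e, he, h⟩ := Metric.mem_nhds_iff.1 (mem_interior_iff_mem_nhds.1 hy)
    exact ⟨y.2, e, he, fun x hx hxy => h (show (⟨x, hx⟩ : affineSpan ℝ F) ∈ Metric.ball y e from hxy)⟩
  · rintro ⟨ha, e, he, h⟩
    exact ⟨⟨a, ha⟩, mem_interior_iff_mem_nhds.2 (Metric.mem_nhds_iff.2 ⟨e, he, fun x hx =>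
      h x x.2 hx⟩), rfl⟩

theorem IsFaceOf.eq_of_mem_relint {F D : Set (Fin d → ℝ)} (hF : IsFaceOf F D)
    {a : Fin d → ℝ} (ha : a ∈ relint D) (haF : a ∈ F) (hD : IsConvexCone D) : F = D := by
  refine hF.2.1.antisymm fun x hx => ?_
  obtain ⟨haff, e, he, h⟩ := mem_relint_iff.1 ha
  obtain ⟨t, ht, hte⟩ : ∃ t : ℝ, 0 < t ∧ t * dist a x < e := by
    have hpos : 0 < dist a x + 1 := by positivity
    refine ⟨e / (dist a x + 1), by positivity, ?_⟩
    rw [div_mul_eq_mul_div, div_lt_iff₀ hpos]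
    nlinarith
  have hmem : t • (a - x) + a ∈ affineSpan ℝ D :=
    AffineSubspace.smul_vsub_vadd_mem _ t haff (subset_affineSpan ℝ D hx) haff
  have h1 : t • (a - x) + a ∈ D := h _ hmem (by
    rw [dist_eq_norm, add_sub_cancel_right, norm_smul, Real.norm_of_nonneg ht.le, ← dist_eq_norm]
    exact hte)
  have h2 := hF.2.2 _ h1 (t • x) (hD.2.2 x hx t ht.le) (by
    have : t • (a - x) + a + t • x = (1 + t) • a := by module
    rw [this]
    exact hF.1.2.2 a haF _ (by positivity))
  exact hF.1.mem_of_smul_mem ht h2.2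

theorem mem_relint_of_forall_face {D : Set (Fin d → ℝ)} (hD : IsConvexCone D) {a : Fin d → ℝ}
    (ha : a ∈ D) (h : ∀ F, IsFaceOf F D → a ∈ F → F = D) : a ∈ relint D := by
  have hconv : Convex ℝ D := fun x hx y hy s t hs ht _ =>
    hD.2.1 _ (hD.2.2 x hx s hs) _ (hD.2.2 y hy t ht)
  obtain ⟨z, hz⟩ := Set.Nonempty.intrinsicInterior hconv ⟨0, hD.1⟩
  have hface : IsFaceOf {x ∈ D | ∃ t : ℝ, 0 < t ∧ ∃ w ∈ D, a = t • x + w} D := by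
    refine ⟨⟨⟨hD.1, 1, one_pos, a, ha, by simp⟩, ?_, ?_⟩, fun x hx => hx.1, ?_⟩
    · rintro x ⟨hx, t, ht, w, hw, h1⟩ y ⟨hy, s, hs, v, hv, h2⟩
      refine ⟨hD.2.1 x hx y hy, (s + t)⁻¹ * (s * t), by positivity, (s + t)⁻¹ • (s • w + t • v),
        hD.2.2 _ (hD.2.1 _ (hD.2.2 w hw s hs.le) _ (hD.2.2 v hv t ht.le)) _ (by positivity), ?_⟩
      have h3 : (s + t) • a = (s * t) • (x + y) + (s • w + t • v) := by
        have : (s + t) • a = s • (t • x + w) + t • (s • y + v) := by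
          rw [← h1, ← h2, add_smul]
        rw [this]
        module
      rw [mul_smul, ← smul_add, ← h3, smul_smul, inv_mul_cancel₀ (by positivity), one_smul]
    · rintro x ⟨hx, t, ht, w, hw, h1⟩ c hc
      refine ⟨hD.2.2 x hx c hc, ?_⟩
      rcases hc.eq_or_lt with rfl | hc
      · exact ⟨1, one_pos, a, ha, by simp⟩
      · refine ⟨t / c, by positivity, w, hw, ?_⟩
        rwa [smul_smul, div_mul_cancel₀ _ hc.ne']
    · rintro x hx y hy ⟨-, t, ht, w, hw, h1⟩
      refine ⟨⟨hx, t, ht, t • y + w, hD.2.1 _ (hD.2.2 y hy t ht.le) w hw, ?_⟩,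
        hy, t, ht, t • x + w, hD.2.1 _ (hD.2.2 x hx t ht.le) w hw, ?_⟩ <;> rw [h1] <;> module
  have hall := h _ hface ⟨ha, 1, one_pos, 0, hD.1, by simp⟩
  obtain ⟨haff, e, he, hball⟩ := mem_relint_iff.1 hz
  have hzD : z ∈ D := intrinsicInterior_subset hz
  rw [← hall] at hzD
  obtain ⟨-, t, ht, w, hw, haz⟩ := hzD
  refine mem_relint_iff.2 ⟨subset_affineSpan ℝ D ha, t * e, by positivity, fun x hx hxa => ?_⟩
  have hmem : t⁻¹ • (x - a) + z ∈ affineSpan ℝ D :=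
    AffineSubspace.smul_vsub_vadd_mem _ t⁻¹ hx (subset_affineSpan ℝ D ha) haff
  have h1 := hball _ hmem (by
    rw [dist_eq_norm, add_sub_cancel_right, norm_smul, Real.norm_of_nonneg (by positivity),
      ← dist_eq_norm, inv_mul_lt_iff₀ ht]
    exact hxa)
  have h2 : x = t • (t⁻¹ • (x - a) + z) + w := by
    rw [smul_add, smul_smul, mul_inv_cancel₀ ht.ne', one_smul, add_assoc, ← haz]
    simp
  rw [h2]
  exact hD.2.1 _ (hD.2.2 _ h1 t ht.le) w hw

theorem Z2R_add (a b : Fin d → ℤ) : Z2R (a + b) = Z2R a + Z2R b := by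
  ext i; simp [Z2R]

theorem Z2R_zero : Z2R (0 : Fin d → ℤ) = 0 := by
  ext i; simp [Z2R]

theorem Z2R_sum {ι : Type*} (s : Finset ι) (f : ι → Fin d → ℤ) :
    Z2R (∑ i ∈ s, f i) = ∑ i ∈ s, Z2R (f i) := by
  ext i; simp [Z2R]

theorem exists_Z2R_eq_smul {v : Fin d → ℝ} (hv : ∀ i, ∃ q : ℚ, v i = q) :
    ∃ (t : ℝ) (a : Fin d → ℤ), 0 < t ∧ Z2R a = t • v := by
  choose q hq using hv
  refine ⟨∏ i, ((q i).den : ℝ), fun i => (q i).num * ∏ j ∈ Finset.univ.erase i, ((q j).den : ℤ),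
    Finset.prod_pos fun i _ => by exact_mod_cast (q i).den_pos, ?_⟩
  ext i
  have h1 : ((q i).den : ℝ) * (q i : ℝ) = (q i).num := by
    exact_mod_cast Rat.den_mul_eq_num (q i)
  rw [← Finset.mul_prod_erase _ _ (Finset.mem_univ i)]
  simp only [Z2R, Pi.smul_apply, smul_eq_mul, hq]
  push_cast
  rw [← h1]
  ring

variable (Φ : Fan d) {C : Set (Fin d → ℝ)}

/-- A rational cone contains a lattice point lying on no proper face. -/
theorem Fan.exists_pos_lattice_point (hC : C ∈ Φ.cones) :
    ∃ a : Fin d → ℤ, Z2R a ∈ C ∧ ∀ F, IsFaceOf F C → Z2R a ∈ F → F = C := by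
  have hconv := Φ.isConvexCone hC
  obtain ⟨⟨S, hS, rfl⟩, -⟩ := Φ.pointed C hC
  have key : ∀ v ∈ S, ∃ (t : ℝ) (a : Fin d → ℤ), 0 < t ∧ Z2R a = t • v := fun v hv =>
    exists_Z2R_eq_smul (hS v hv)
  choose! t a ht ha using key
  have haC : ∀ v ∈ S, Z2R (a v) ∈ conicalHull S := fun v hv => by
    rw [ha v hv]
    exact hconv.2.2 v (subset_conicalHull S hv) _ (ht v hv).le
  refine ⟨∑ v ∈ S, a v, by rw [Z2R_sum]; exact hconv.sum_mem _ _ haC,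
    fun F hF h => hF.2.1.antisymm ?_⟩
  rw [Z2R_sum] at h
  rintro _ ⟨c, hc, rfl⟩
  refine hF.1.sum_mem _ _ fun v hv => hF.1.2.2 _ ?_ _ (hc v)
  have := hF.mem_of_sum_mem hconv S _ haC h v hv
  rw [ha v hv] at this
  exact hF.1.mem_of_smul_mem (ht v hv) this

/-- Every point of a cone lies in the relative interior of a face. -/
theorem Fan.exists_mem_relint (hC : C ∈ Φ.cones) {a : Fin d → ℝ} (ha : a ∈ C) :
    ∃ D ∈ faceSet Φ C, a ∈ relint D := by
  have hfin : {D | D ∈ faceSet Φ C ∧ a ∈ D}.Finite := Φ.finite.subset fun D hD => hD.1.1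
  obtain ⟨D, hDC, hD⟩ := hfin.exists_le_minimal (a := C) ⟨⟨hC, subset_rfl⟩, ha⟩
  refine ⟨D, hD.1.1, mem_relint_of_forall_face (Φ.isConvexCone hD.1.1.1) hD.1.2 fun F hF haF => ?_⟩
  have hFD := (Φ.isFaceOf_iff hD.1.1.1).1 hF
  exact hFD.2.antisymm (hD.2 ⟨⟨hFD.1, hFD.2.trans hDC⟩, haF⟩ hFD.2)

/-- If the lattice points of a cone outside given cones form a translate `γ + C`, then the faces of
`C` outside these cones form the star of `γ`, and the translate is the set of lattice points in the
relative interiors of these faces. -/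
theorem Fan.star_of_translate (hC : C ∈ Φ.cones) {T : Set (Set (Fin d → ℝ))} (hT : T ⊆ Φ.cones)
    {γ : Fin d → ℤ}
    (hγ : ∀ a : Fin d → ℤ, (Z2R a ∈ C ∧ ∀ E ∈ T, Z2R a ∉ E) ↔ ∃ b, Z2R b ∈ C ∧ a = γ + b) :
    {D ∈ faceSet Φ C | Z2R γ ∈ D} = faceSet Φ C \ (⋃ E ∈ T, faceSet Φ E) ∧
      {a : Fin d → ℤ | ∃ D ∈ faceSet Φ C, Z2R γ ∈ D ∧ Z2R a ∈ relint D} =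
        {a : Fin d → ℤ | ∃ b : Fin d → ℤ, Z2R b ∈ C ∧ a = γ + b} := by
  have hγC : Z2R γ ∈ C ∧ ∀ E ∈ T, Z2R γ ∉ E :=
    (hγ γ).2 ⟨0, by rw [Z2R_zero]; exact (Φ.isConvexCone hC).1, by simp⟩
  have hmem : ∀ D ∈ faceSet Φ C, ∀ a, Z2R a ∈ D → (∀ E ∈ T, Z2R a ∉ E) → Z2R γ ∈ D := by
    intro D hD a haD haT
    obtain ⟨b, hb, rfl⟩ := (hγ a).1 ⟨hD.2 haD, haT⟩
    rw [Z2R_add] at haD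
    exact (((Φ.isFaceOf_iff hC).2 hD).2.2 _ hγC.1 _ hb haD).1
  constructor
  · ext D
    simp only [Set.mem_ofPred_eq, Set.mem_sdiff, Set.mem_iUnion, exists_prop, not_exists, not_and]
    refine and_congr_right fun hD => ⟨fun h E hE hDE => hγC.2 E hE (hDE.2 h), fun h => ?_⟩
    obtain ⟨a, haD, ha⟩ := Φ.exists_pos_lattice_point hD.1
    refine hmem D hD a haD fun E hE haE => h E hE ⟨hD.1, ?_⟩
    exact Set.inter_eq_left.1 (ha _ (Φ.inter_face D hD.1 E (hT hE)).1 ⟨haD, haE⟩)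
  · ext a
    simp only [Set.mem_ofPred_eq]
    constructor
    · rintro ⟨D, hD, hγD, ha⟩
      have haD : Z2R a ∈ D := intrinsicInterior_subset ha
      refine (hγ a).1 ⟨hD.2 haD, fun E hE haE => hγC.2 E hE ?_⟩
      have := (Φ.inter_face D hD.1 E (hT hE)).1.eq_of_mem_relint ha ⟨haD, haE⟩
        (Φ.isConvexCone hD.1)
      exact Set.inter_eq_left.1 this hγD
    · intro h
      obtain ⟨haC, haT⟩ := (hγ a).2 h
      obtain ⟨D, hD, ha⟩ := Φ.exists_mem_relint hC haC
      exact ⟨D, hD, hmem D hD a (intrinsicInterior_subset ha) haT, ha⟩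

end Relint

/-! ### The projections of the toric face ring onto its cones -/

section ToricFaceRing

variable (K : Type) [Field K] {d : ℕ} (Φ : Fan d) {C : Set (Fin d → ℝ)}

theorem xpow_eq_zero {a : Fin d → ℤ} (ha : a ∉ Φ.supp) : xpow K Φ a = 0 := by
  rw [xpow, Fan.Xaux, dif_neg ha]
  exact map_zero (Ideal.Quotient.mk (Φ.relIdeal K))

theorem xpow_mul_xpow {a b : Fin d → ℤ} (h : ∃ C ∈ Φ.cones, Z2R a ∈ C ∧ Z2R b ∈ C) :
    xpow K Φ a * xpow K Φ b = xpow K Φ (a + b) := by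
  obtain ⟨C, hC, ha, hb⟩ := h
  have ha' : a ∈ Φ.supp := ⟨C, hC, ha⟩
  have hb' : b ∈ Φ.supp := ⟨C, hC, hb⟩
  refine Eq.trans (map_mul (Ideal.Quotient.mk (Φ.relIdeal K)) _ _).symm
    (Ideal.Quotient.eq.2 (Ideal.subset_span (Or.inl (Or.inl ?_))))
  exact ⟨⟨a, ha'⟩, ⟨b, hb'⟩, ⟨C, hC, ha, hb⟩, by rw [Fan.Xaux, Fan.Xaux, dif_pos ha', dif_pos hb']⟩

theorem xpow_mul_xpow_eq_zero {a b : Fin d → ℤ} (h : ¬ ∃ C ∈ Φ.cones, Z2R a ∈ C ∧ Z2R b ∈ C) :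
    xpow K Φ a * xpow K Φ b = 0 := by
  by_cases ha : a ∈ Φ.supp; swap
  · rw [xpow_eq_zero K Φ ha, zero_mul]
  by_cases hb : b ∈ Φ.supp; swap
  · rw [xpow_eq_zero K Φ hb, mul_zero]
  refine Eq.trans (map_mul (Ideal.Quotient.mk (Φ.relIdeal K)) _ _).symm
    (Ideal.Quotient.eq_zero_iff_mem.2 (Ideal.subset_span (Or.inl (Or.inr ?_))))
  exact ⟨⟨a, ha⟩, ⟨b, hb⟩, h, by rw [Fan.Xaux, Fan.Xaux, dif_pos ha, dif_pos hb]⟩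

theorem xpow_zero_eq_one (hC : C ∈ Φ.cones) : xpow K Φ 0 = 1 := by
  have h0 : (0 : Fin d → ℤ) ∈ Φ.supp := ⟨C, hC, by rw [Z2R_zero]; exact (Φ.isConvexCone hC).1⟩
  refine Eq.trans (Ideal.Quotient.eq.2 (Ideal.subset_span (Or.inr ⟨⟨0, h0⟩, rfl, ?_⟩)))
    (map_one (Ideal.Quotient.mk (Φ.relIdeal K)))
  rw [Fan.Xaux, dif_pos h0]

theorem span_range_xpow (hC : C ∈ Φ.cones) :
    Submodule.span K (Set.range fun a : Φ.supp => xpow K Φ a) = ⊤ := by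
  rw [eq_top_iff]
  rintro r -
  let π : Φ.polyRing K →+* ToricFaceRing K Φ := Ideal.Quotient.mk (Φ.relIdeal K)
  obtain ⟨p, rfl⟩ : ∃ p, π p = r := Ideal.Quotient.mk_surjective r
  have h0 : (0 : Fin d → ℤ) ∈ Φ.supp := ⟨C, hC, by rw [Z2R_zero]; exact (Φ.isConvexCone hC).1⟩
  induction p using MvPolynomial.induction_on with
  | C c =>
    have : π (MvPolynomial.C c) = c • xpow K Φ 0 := by
      rw [xpow_zero_eq_one K Φ hC, Algebra.smul_def, mul_one]
      rfl
    rw [this]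
    exact Submodule.smul_mem _ _ (Submodule.subset_span ⟨⟨0, h0⟩, rfl⟩)
  | add p q hp hq => rw [map_add]; exact Submodule.add_mem _ hp hq
  | mul_X p m hp =>
    have hX : π (MvPolynomial.X m) = xpow K Φ m := by
      rw [xpow, Fan.Xaux, dif_pos m.2]
      rfl
    rw [map_mul, hX]
    generalize π p = q at hp
    induction hp using Submodule.span_induction with
    | mem x hx =>
      obtain ⟨a, rfl⟩ := hx
      by_cases h : ∃ C ∈ Φ.cones, Z2R a.1 ∈ C ∧ Z2R m.1 ∈ C
      · obtain ⟨D, hD, ha, hm⟩ := h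
        dsimp only
        rw [xpow_mul_xpow K Φ ⟨D, hD, ha, hm⟩]
        refine Submodule.subset_span ⟨⟨a + m, D, hD, ?_⟩, rfl⟩
        rw [Z2R_add]
        exact (Φ.isConvexCone hD).2.1 _ ha _ hm
      · dsimp only
        rw [xpow_mul_xpow_eq_zero K Φ h]
        exact Submodule.zero_mem _
    | zero => rw [zero_mul]; exact Submodule.zero_mem _
    | add x y _ _ hx hy => rw [add_mul]; exact Submodule.add_mem _ hx hy
    | smul c x _ hx => rw [smul_mul_assoc]; exact Submodule.smul_mem _ _ hx

/-- The projection of the toric face ring onto the semigroup ring of a cone. -/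
def Fan.coneHom (hC : C ∈ Φ.cones) :
    ToricFaceRing K Φ →ₐ[K] AddMonoidAlgebra K (Fin d → ℤ) :=
  Ideal.Quotient.liftₐ (Φ.relIdeal K)
    (MvPolynomial.aeval fun m : Φ.supp =>
      if Z2R m.1 ∈ C then AddMonoidAlgebra.single m.1 (1 : K) else 0) <| by
    have hX : ∀ m : Φ.supp, MvPolynomial.aeval (fun m : Φ.supp =>
        if Z2R m.1 ∈ C then AddMonoidAlgebra.single m.1 (1 : K) else 0) (Φ.X K m) =
        if Z2R m.1 ∈ C then AddMonoidAlgebra.single m.1 (1 : K) else 0 := fun m =>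
      MvPolynomial.aeval_X _ m
    intro z hz
    induction hz using Submodule.span_induction with
    | mem x hx =>
      rcases hx with (⟨a, b, ⟨D, hD, ha, hb⟩, rfl⟩ | ⟨a, b, hab, rfl⟩) | ⟨a, ha, rfl⟩
      · have hmem : Z2R (a.1 + b.1) ∈ D := by
          rw [Z2R_add]
          exact (Φ.isConvexCone hD).2.1 _ ha _ hb
        have hiff : Z2R (a.1 + b.1) ∈ C ↔ Z2R a.1 ∈ C ∧ Z2R b.1 ∈ C := by
          constructor
          · intro h
            have := (Φ.inter_face D hD C hC).1.2.2 _ ha _ hb (by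
              rw [← Z2R_add]
              exact ⟨hmem, h⟩)
            exact ⟨this.1.2, this.2.2⟩
          · rintro ⟨h1, h2⟩
            rw [Z2R_add]
            exact (Φ.isConvexCone hC).2.1 _ h1 _ h2
        rw [Fan.Xaux, dif_pos ⟨D, hD, hmem⟩, map_sub, map_mul, hX, hX, hX, sub_eq_zero]
        simp only [hiff]
        by_cases h1 : Z2R a.1 ∈ C <;> by_cases h2 : Z2R b.1 ∈ C <;>
          simp [h1, h2, AddMonoidAlgebra.single_mul_single]
      · rw [map_mul, hX, hX]
        by_cases h1 : Z2R a.1 ∈ C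
        · rw [if_neg fun h2 => hab ⟨C, hC, h1, h2⟩, mul_zero]
        · rw [if_neg h1, zero_mul]
      · rw [map_sub, hX, map_one, ha, Z2R_zero, if_pos (Φ.isConvexCone hC).1, sub_eq_zero]
        rfl
    | zero => exact map_zero _
    | add x y _ _ hx hy => rw [map_add, hx, hy, add_zero]
    | smul c x _ hx => rw [smul_eq_mul, map_mul, hx, mul_zero]

theorem Fan.coneHom_xpow (hC : C ∈ Φ.cones) (a : Fin d → ℤ) :
    Φ.coneHom K hC (xpow K Φ a) =
      if Z2R a ∈ C then AddMonoidAlgebra.single a (1 : K) else 0 := by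
  by_cases ha : a ∈ Φ.supp
  · rw [xpow, Fan.Xaux, dif_pos ha]
    exact MvPolynomial.aeval_X _ (⟨a, ha⟩ : Φ.supp)
  · rw [xpow_eq_zero K Φ ha, map_zero, if_neg fun h => ha ⟨C, hC, h⟩]

/-- The family of coefficients of an element of the toric face ring. -/
theorem Fan.exists_coeff (hC : C ∈ Φ.cones) (r : ToricFaceRing K Φ) :
    ∃ c : (Fin d → ℤ) → K, (∀ D (hD : D ∈ Φ.cones) a,
      (Φ.coneHom K hD r).coeff a = if Z2R a ∈ D then c a else 0) ∧
      ((∀ a ∈ Φ.supp, c a = 0) → r = 0) := by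
  have hr : r ∈ Submodule.span K (Set.range fun a : Φ.supp => xpow K Φ a) := by
    rw [span_range_xpow K Φ hC]; trivial
  obtain ⟨c, rfl⟩ := (Finsupp.mem_span_range_iff_exists_finsupp).1 hr
  refine ⟨fun a => if h : a ∈ Φ.supp then c ⟨a, h⟩ else 0, fun D hD a => ?_, fun h => ?_⟩
  · have hcoeff : ∀ m : Φ.supp, ((Φ.coneHom K hD) (c m • xpow K Φ m.1)).coeff a =
        if m.1 = a then (if Z2R a ∈ D then c m else 0) else 0 := fun m => by
      rw [map_smul, Fan.coneHom_xpow]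
      by_cases hm : m.1 = a
      · subst hm
        by_cases h : Z2R m.1 ∈ D <;> simp [h]
      · by_cases h : Z2R m.1 ∈ D <;> simp [h, hm]
    rw [Finsupp.sum, map_sum, AddMonoidAlgebra.coeff_sum, Finsupp.finsetSum_apply,
      Finset.sum_congr rfl fun m _ => hcoeff m]
    by_cases ha : a ∈ Φ.supp
    · rw [Finset.sum_eq_single (⟨a, ha⟩ : Φ.supp)]
      · simp [ha]
      · intro b _ hb
        rw [if_neg fun h => hb (Subtype.ext h)]
      · intro hb
        rw [if_pos rfl, Finsupp.notMem_support_iff.1 hb, ite_self]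
    · rw [if_neg fun h => ha ⟨D, hD, h⟩]
      exact Finset.sum_eq_zero fun m _ => if_neg fun h : m.1 = a => ha (h ▸ m.2)
  · have : c = 0 := by
      ext m
      simpa [m.2] using h m m.2
    rw [this, Finsupp.sum_zero_index]

end ToricFaceRing

/-! ### Prime filtrations -/

section Filtration

variable {R : Type*} [CommRing R] {n : ℕ} {M : Fin (n + 1) → Submodule R R} {P : Fin n → Ideal R}

/-- The generators of the factors of a prime filtration of a ring. -/
theorem exists_filtration_generator {M₀ M₁ : Submodule R R} {p : Ideal R}
    (e : (↥M₁ ⧸ Submodule.comap M₁.subtype M₀) ≃ₗ[R] (R ⧸ p)) :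
    ∃ m ∈ M₁, (∀ r, r * m ∈ M₀ ↔ r ∈ p) ∧ ∀ y ∈ M₁, ∃ c, y - c * m ∈ M₀ := by
  obtain ⟨m, hm⟩ := Submodule.Quotient.mk_surjective _ (e.symm (Submodule.Quotient.mk 1))
  have key : ∀ r, e (Submodule.Quotient.mk (r • m)) = Submodule.Quotient.mk r := fun r => by
    rw [Submodule.Quotient.mk_smul, hm, map_smul, e.apply_symm_apply, ← Submodule.Quotient.mk_smul,
      smul_eq_mul, mul_one]
  refine ⟨m, m.2, fun r => ?_, fun y hy => ?_⟩
  · rw [← Submodule.Quotient.mk_eq_zero p, ← key, e.map_eq_zero_iff, Submodule.Quotient.mk_eq_zero]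
    rfl
  · obtain ⟨c, hc⟩ := Submodule.Quotient.mk_surjective _ (e (Submodule.Quotient.mk ⟨y, hy⟩))
    rw [← key c] at hc
    exact ⟨c, (Submodule.Quotient.eq (Submodule.comap M₁.subtype M₀)).1 (e.injective hc).symm⟩

/-- In a prime filtration of a ring whose primes `P` each satisfy `e * P = 0` for some `e ∉ P`,
the generators of the factors separate the primes. -/
theorem exists_separating_generators (hlast : M (Fin.last n) = ⊤)
    (hmono : ∀ i : Fin n, M i.castSucc ≤ M i.succ)
    (hiso : ∀ i : Fin n, Nonempty
      ((↥(M i.succ) ⧸ Submodule.comap (M i.succ).subtype (M i.castSucc)) ≃ₗ[R] (R ⧸ P i)))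
    (hprime : ∀ i, (P i).IsPrime) (hsep : ∀ i, ∃ e, e ∉ P i ∧ ∀ x ∈ P i, e * x = 0) :
    ∃ m : Fin n → R, (∀ i, m i ∉ P i) ∧ (∀ i k, i < k → m i ∈ P k) ∧
      ∀ i x, (∀ k, i < k → x ∈ P k) → ∃ c, x - c * m i ∈ P i := by
  choose m hmem hP hgen using fun i => exists_filtration_generator (hiso i).some
  have hM : Monotone M := Fin.monotone_iff_le_succ.2 hmono
  have hle : ∀ i y, y ∈ M i.castSucc → y ∈ P i := fun i y hy => (hP i y).1 (by
    rw [mul_comm]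
    exact (M i.castSucc).smul_mem (m i) hy)
  have hnot : ∀ i, m i ∉ P i := fun i hi => by
    obtain ⟨e, he, h0⟩ := hsep i
    exact he ((hP i e).1 (by rw [h0 _ hi]; exact Submodule.zero_mem _))
  have hdown : ∀ j : Fin (n + 1), ∀ x, (∀ k : Fin n, j ≤ k.castSucc → x ∈ P k) → x ∈ M j := by
    intro j
    induction j using Fin.reverseInduction with
    | last => intro x _; rw [hlast]; trivial
    | cast i ih =>
      intro x hx
      obtain ⟨c, hc⟩ := hgen i x (ih x fun k hk => hx k (i.castSucc_lt_succ.le.trans hk))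
      have h1 : c * m i ∈ P i := by
        have := (P i).sub_mem (hx i le_rfl) (hle i _ hc)
        rwa [sub_sub_cancel] at this
      have h2 := (hP i c).2 (((hprime i).mem_or_mem h1).resolve_right (hnot i))
      have := (M i.castSucc).add_mem hc h2
      rwa [sub_add_cancel] at this
  refine ⟨m, hnot, fun i k hik => hle k _ (hM (Fin.succ_le_castSucc_iff.2 hik) (hmem i)),
    fun i x hx => ?_⟩
  obtain ⟨c, hc⟩ := hgen i x (hdown i.succ x fun k hk => hx k (Fin.succ_le_castSucc_iff.1 hk))
  exact ⟨c, hle i _ hc⟩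

end Filtration

/-- A divisor of a monomial is a monomial. -/
theorem AddMonoidAlgebra.exists_eq_single_of_mul_eq_single {K G : Type*} [Field K] [AddGroup G]
    [TwoUniqueSums G] {g f : AddMonoidAlgebra K G} {a : G}
    (h : g * f = AddMonoidAlgebra.single a 1) :
    ∃ b, ∃ c : K, c ≠ 0 ∧ f = AddMonoidAlgebra.single b c := by
  have hne : g * f ≠ 0 := by
    rw [h]
    intro h0
    have := congrArg (fun x => AddMonoidAlgebra.coeff x a) h0
    simp at this
  have hsum : ∀ p ∈ g.coeff.support ×ˢ f.coeff.support,
      UniqueAdd g.coeff.support f.coeff.support p.1 p.2 → p.1 + p.2 = a := by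
    intro p hp hu
    rw [Finset.mem_product, Finsupp.mem_support_iff, Finsupp.mem_support_iff] at hp
    by_contra hpa
    have := AddMonoidAlgebra.coeff_mul_add_of_uniqueAdd hu
    rw [h, AddMonoidAlgebra.coeff_single, Finsupp.single_eq_of_ne hpa] at this
    exact mul_ne_zero hp.1 hp.2 this.symm
  have hg : 0 < g.coeff.support.card := by
    rw [Finset.card_pos, Finsupp.support_nonempty_iff]
    exact fun h0 => left_ne_zero_of_mul hne (AddMonoidAlgebra.coeff_eq_zero.1 h0)
  have hf : 0 < f.coeff.support.card := by
    rw [Finset.card_pos, Finsupp.support_nonempty_iff]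
    exact fun h0 => right_ne_zero_of_mul hne (AddMonoidAlgebra.coeff_eq_zero.1 h0)
  have hcard : f.coeff.support.card = 1 := by
    by_contra h1
    obtain ⟨p, hp, q, hq, hpq, hup, huq⟩ :=
      TwoUniqueSums.uniqueAdd_of_one_lt_card (A := g.coeff.support) (B := f.coeff.support)
        (by nlinarith [Nat.lt_of_le_of_ne hf (Ne.symm h1)])
    rw [Finset.mem_product] at hq
    have := hup hq.1 hq.2
      ((hsum q (Finset.mem_product.2 hq) huq).trans (hsum p hp hup).symm)
    exact hpq (Prod.ext this.1.symm this.2.symm)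
  obtain ⟨b, hb, hfb⟩ := Finsupp.card_support_eq_one.1 hcard
  exact ⟨b, f.coeff b, hb, by ext1; exact hfb⟩

/-! ### The primes of the facets -/

section ConePrimes

variable (K : Type) [Field K] {d : ℕ} (Φ : Fan d) {C : Set (Fin d → ℝ)}

/-- A facet contains a lattice point lying in no other facet. -/
theorem Fan.exists_facet_lattice_point (hC : IsFacet Φ C) :
    ∃ a : Fin d → ℤ, Z2R a ∈ C ∧ ∀ D ∈ Φ.cones, Z2R a ∈ D → D = C := by
  obtain ⟨a, haC, ha⟩ := Φ.exists_pos_lattice_point hC.1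
  exact ⟨a, haC, fun D hD haD => hC.2 D hD
    (Set.inter_eq_left.1 (ha _ (Φ.inter_face C hC.1 D hD).1 ⟨haC, haD⟩))⟩

theorem Fan.exists_facet_superset (hC : C ∈ Φ.cones) : ∃ D, IsFacet Φ D ∧ C ⊆ D := by
  obtain ⟨D, hCD, hD⟩ := Φ.finite.exists_le_maximal hC
  exact ⟨D, ⟨hD.1, fun E hE h => (hD.2 hE h).antisymm h⟩, hCD⟩

theorem Fan.xpow_mem_ker_iff (hC : C ∈ Φ.cones) {a : Fin d → ℤ} :
    xpow K Φ a ∈ RingHom.ker (Φ.coneHom K hC) ↔ Z2R a ∉ C := by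
  rw [RingHom.mem_ker, Fan.coneHom_xpow]
  split_ifs with h
  · refine iff_of_false (fun h0 => ?_) (not_not.2 h)
    have := congrArg (fun x => AddMonoidAlgebra.coeff x a) h0
    simp at this
  · exact iff_of_true rfl h

theorem Fan.eq_zero_of_forall_facet {r : ToricFaceRing K Φ} (hC : C ∈ Φ.cones)
    (h : ∀ D (hD : IsFacet Φ D), r ∈ RingHom.ker (Φ.coneHom K hD.1)) : r = 0 := by
  obtain ⟨c, hc, h0⟩ := Φ.exists_coeff K hC r
  refine h0 fun a ⟨D, hD, ha⟩ => ?_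
  obtain ⟨E, hE, hDE⟩ := Φ.exists_facet_superset hD
  have := hc E hE.1 a
  rw [if_pos (hDE ha), (RingHom.mem_ker.1 (h E hE) :)] at this
  exact this.symm

instance (hC : C ∈ Φ.cones) : (RingHom.ker (Φ.coneHom K hC)).IsPrime := RingHom.ker_isPrime _

/-- The minimal primes of the toric face ring are the primes of the facets. -/
theorem Fan.mem_minimalPrimes_iff (hC : C ∈ Φ.cones) {p : Ideal (ToricFaceRing K Φ)} :
    p ∈ minimalPrimes (ToricFaceRing K Φ) ↔
      ∃ D, ∃ hD : IsFacet Φ D, p = RingHom.ker (Φ.coneHom K hD.1) := by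
  have hle : ∀ q : Ideal (ToricFaceRing K Φ), q.IsPrime →
      ∃ D, ∃ hD : IsFacet Φ D, RingHom.ker (Φ.coneHom K hD.1) ≤ q := by
    intro q hq
    have : Finite {D // IsFacet Φ D} := (Φ.finite.subset fun D (hD : IsFacet Φ D) => hD.1).to_subtype
    have : Fintype {D // IsFacet Φ D} := Fintype.ofFinite _
    let f : {D // IsFacet Φ D} → Ideal (ToricFaceRing K Φ) := fun D =>
      RingHom.ker (Φ.coneHom K D.2.1)
    obtain ⟨D, -, hD⟩ := (hq.inf_le' (s := Finset.univ) (f := f)).1 fun x hx => by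
      rw [Φ.eq_zero_of_forall_facet K (r := x) hC fun D hD =>
        Finset.inf_le (f := f) (Finset.mem_univ ⟨D, hD⟩) hx]
      exact q.zero_mem
    exact ⟨D.1, D.2, hD⟩
  rw [minimalPrimes_eq_minimals]
  constructor
  · intro hp
    obtain ⟨D, hD, h⟩ := hle p hp.1
    exact ⟨D, hD, (hp.2 (inferInstance : (RingHom.ker (Φ.coneHom K hD.1)).IsPrime) h).antisymm h⟩
  · rintro ⟨D, hD, rfl⟩
    refine ⟨(inferInstance : (RingHom.ker (Φ.coneHom K hD.1)).IsPrime), fun q hq hqD => ?_⟩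
    obtain ⟨E, hE, hEq⟩ := hle q hq
    obtain ⟨a, haD, ha⟩ := Φ.exists_facet_lattice_point hD
    have haE : Z2R a ∈ E := by
      by_contra h
      exact (Φ.xpow_mem_ker_iff K hD.1).1 (hqD (hEq ((Φ.xpow_mem_ker_iff K hE.1).2 h))) haD
    obtain rfl := ha E hE.1 haE
    exact hEq

/-- The prime of a facet is annihilated by an element outside it. -/
theorem Fan.exists_mul_eq_zero (hC : IsFacet Φ C) :
    ∃ e, e ∉ RingHom.ker (Φ.coneHom K hC.1) ∧
      ∀ x ∈ RingHom.ker (Φ.coneHom K hC.1), e * x = 0 := by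
  obtain ⟨a, haC, ha⟩ := Φ.exists_facet_lattice_point hC
  refine ⟨xpow K Φ a, fun h => (Φ.xpow_mem_ker_iff K hC.1).1 h haC, fun x hx =>
    Φ.eq_zero_of_forall_facet K hC.1 fun D hD => ?_⟩
  by_cases h : Z2R a ∈ D
  · obtain rfl := ha D hD.1 h
    exact Ideal.mul_mem_left _ _ hx
  · exact Ideal.mul_mem_right _ _ ((Φ.xpow_mem_ker_iff K hD.1).2 h)

/-- If the monomials of a cone outside given cones are multiples of an element `m` vanishing on
these cones, then their exponents form a translate of the cone. -/
theorem Fan.exists_translate (hC : C ∈ Φ.cones) {T : Set (Set (Fin d → ℝ))} (hT : T ⊆ Φ.cones)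
    (hex : ∃ a : Fin d → ℤ, Z2R a ∈ C ∧ ∀ E ∈ T, Z2R a ∉ E) {m : ToricFaceRing K Φ}
    (hm : ∀ E (hE : E ∈ T), m ∈ RingHom.ker (Φ.coneHom K (hT hE)))
    (hgen : ∀ a : Fin d → ℤ, (∀ E ∈ T, Z2R a ∉ E) →
      ∃ c, xpow K Φ a - c * m ∈ RingHom.ker (Φ.coneHom K hC)) :
    ∃ γ : Fin d → ℤ, ∀ a : Fin d → ℤ,
      (Z2R a ∈ C ∧ ∀ E ∈ T, Z2R a ∉ E) ↔ ∃ b, Z2R b ∈ C ∧ a = γ + b := by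
  have hmul : ∀ a : Fin d → ℤ, Z2R a ∈ C → (∀ E ∈ T, Z2R a ∉ E) → ∃ c,
      Φ.coneHom K hC c * Φ.coneHom K hC m = AddMonoidAlgebra.single a 1 := by
    intro a haC haT
    obtain ⟨c, hc⟩ := hgen a haT
    refine ⟨c, ?_⟩
    rw [RingHom.mem_ker, map_sub, sub_eq_zero, map_mul, Fan.coneHom_xpow, if_pos haC] at hc
    exact hc.symm
  obtain ⟨γ, k, hk, hγ⟩ : ∃ γ, ∃ k : K, k ≠ 0 ∧
      Φ.coneHom K hC m = AddMonoidAlgebra.single γ k := by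
    obtain ⟨a, haC, haT⟩ := hex
    obtain ⟨c, hc⟩ := hmul a haC haT
    exact AddMonoidAlgebra.exists_eq_single_of_mul_eq_single hc
  obtain ⟨f, hf, -⟩ := Φ.exists_coeff K hC m
  have hγf := hf C hC γ
  rw [hγ, AddMonoidAlgebra.coeff_single, Finsupp.single_eq_same] at hγf
  have hγC : Z2R γ ∈ C := by
    by_contra h
    rw [if_neg h] at hγf
    exact hk hγf
  have hγT : ∀ E ∈ T, Z2R γ ∉ E := fun E hE h => by
    have := hf E (hT hE) γ
    rw [if_pos h, RingHom.mem_ker.1 (hm E hE)] at this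
    rw [if_pos hγC, ← this] at hγf
    exact hk hγf
  refine ⟨γ, fun a => ⟨fun ⟨haC, haT⟩ => ?_, ?_⟩⟩
  · obtain ⟨c, hc⟩ := hmul a haC haT
    refine ⟨a - γ, ?_, by abel⟩
    by_contra h
    obtain ⟨g, hg, -⟩ := Φ.exists_coeff K hC c
    have h1 := hg C hC (a - γ)
    rw [if_neg h] at h1
    have h2 := congrArg (fun x => AddMonoidAlgebra.coeff x a) hc
    rw [hγ] at h2
    have h3 : (Φ.coneHom K hC c * AddMonoidAlgebra.single γ k).coeff a =
        (Φ.coneHom K hC c).coeff (a - γ) * k := by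
      rw [← AddMonoidAlgebra.coeff_mul_single_add, sub_add_cancel]
    rw [h1, zero_mul] at h3
    rw [h3] at h2
    simp at h2
  · rintro ⟨b, hb, rfl⟩
    rw [Z2R_add]
    refine ⟨(Φ.isConvexCone hC).2.1 _ hγC _ hb, fun E hE h => hγT E hE ?_⟩
    exact ((Φ.inter_face C hC E (hT hE)).1.2.2 _ hγC _ hb
      ⟨(Φ.isConvexCone hC).2.1 _ hγC _ hb, h⟩).1.2

end ConePrimes

/-- If the toric face ring `K[Φ]` is clean, then `Φ` is shellable; more
precisely there is a shelling `C_1, …, C_s` and, for each `1 < j ≤ s`, a lattice point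
`γ_j ∈ C_j ∩ ℤ^d` with `star_{fan(C_j)}(γ_j) = fan(C_j) ∖ ⋃_{i<j} fan(C_i)` and
`⋃_{D ∈ star_{fan(C_j)}(γ_j)} relint(D) ∩ ℤ^d = γ_j + (C_j ∩ ℤ^d)`. -/
theorem shellable_of_clean (K : Type) [Field K] {d : ℕ} (Φ : Fan d)
    (h : IsCleanRing (ToricFaceRing K Φ)) :
    ∃ L : List (Set (Fin d → ℝ)), IsShelling Φ L ∧
      ∀ j, 0 < j → j < L.length →
        ∃ γ : Fin d → ℤ, Z2R γ ∈ L.getD j ∅ ∧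
          {D ∈ faceSet Φ (L.getD j ∅) | Z2R γ ∈ D} =
            faceSet Φ (L.getD j ∅) \ (⋃ i ∈ Finset.range j, faceSet Φ (L.getD i ∅)) ∧
          {a : Fin d → ℤ | ∃ D ∈ faceSet Φ (L.getD j ∅), Z2R γ ∈ D ∧ Z2R a ∈ relint D} =
            {a : Fin d → ℤ | ∃ b : Fin d → ℤ, Z2R b ∈ L.getD j ∅ ∧ a = γ + b} := by
  by_cases hne : ∃ C, C ∈ Φ.cones; swap
  · refine ⟨[], ⟨0, List.nodup_nil, ?_, ?_⟩, fun j _ hj => absurd hj (Nat.not_lt_zero j)⟩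
    · ext C
      exact iff_of_false List.not_mem_nil fun hC => hne ⟨C, hC.1⟩
    · exact Φ.dim_eq_zero_of_isEmpty (Set.eq_empty_of_forall_notMem fun C hC => hne ⟨C, hC⟩)
  obtain ⟨C₀, hC₀⟩ := hne
  obtain ⟨n, M, P, -, hlast, hmono, hiso, hP⟩ := h
  have hmin : ∀ p, (∃ i, P i = p) ↔ ∃ D, ∃ hD : IsFacet Φ D, p = RingHom.ker (Φ.coneHom K hD.1) :=
    fun p => (Set.ext_iff.1 hP p).trans (Φ.mem_minimalPrimes_iff K hC₀)
  choose F hF hPF using fun i => (hmin (P i)).1 ⟨i, rfl⟩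
  obtain ⟨m, hmi, hmk, hgen⟩ := exists_separating_generators hlast hmono hiso
    (fun i => by rw [hPF]; infer_instance) (fun i => by rw [hPF]; exact Φ.exists_mul_eq_zero K (hF i))
  have hker : ∀ {D E : Set (Fin d → ℝ)} (hD : D ∈ Φ.cones) (hE : E ∈ Φ.cones), D = E →
      RingHom.ker (Φ.coneHom K hD) = RingHom.ker (Φ.coneHom K hE) := by
    rintro D _ hD hE rfl; rfl
  have hinj : ∀ {i k}, i < k → F i ≠ F k := fun {i k} hik h => hmi i (by
    rw [hPF, hker (hF i).1 (hF k).1 h, ← hPF]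
    exact hmk i k hik)
  have hFinj : Function.Injective F := fun i k h => by
    by_contra hne
    rcases lt_or_gt_of_ne hne with hlt | hlt
    exacts [hinj hlt h, hinj hlt h.symm]
  have htranslate : ∀ i, ∃ γ : Fin d → ℤ, ∀ a : Fin d → ℤ,
      (Z2R a ∈ F i ∧ ∀ E ∈ F '' Set.Ioi i, Z2R a ∉ E) ↔ ∃ b, Z2R b ∈ F i ∧ a = γ + b := by
    intro i
    have hT : F '' Set.Ioi i ⊆ Φ.cones := by
      rintro _ ⟨k, -, rfl⟩
      exact (hF k).1
    refine Φ.exists_translate K (hF i).1 hT ?_ (m := m i) ?_ fun a ha => ?_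
    · obtain ⟨a, haF, ha⟩ := Φ.exists_facet_lattice_point (hF i)
      refine ⟨a, haF, ?_⟩
      rintro _ ⟨k, hk, rfl⟩ hak
      exact hinj hk (ha _ (hF k).1 hak).symm
    · rintro _ ⟨k, hk, rfl⟩
      rw [← hPF]
      exact hmk i k hk
    · rw [← hPF]
      refine hgen i _ fun k hk => ?_
      rw [hPF, Φ.xpow_mem_ker_iff K]
      exact ha _ ⟨k, hk, rfl⟩
  let L := List.ofFn fun i : Fin n => F i.rev
  have hget : ∀ j (hj : j < n), L.getD j ∅ = F (Fin.rev ⟨j, hj⟩) := fun j hj => by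
    rw [List.getD_eq_getElem _ _ (by simpa [L] using hj)]
    simp [L]
  have hunion : ∀ j (hj : j < n), (⋃ i ∈ Finset.range j, faceSet Φ (L.getD i ∅)) =
      ⋃ E ∈ F '' Set.Ioi (Fin.rev ⟨j, hj⟩), faceSet Φ E := by
    intro j hj
    ext D
    simp only [Set.mem_iUnion, Finset.mem_range, exists_prop, Set.exists_mem_image, Set.mem_Ioi]
    constructor
    · rintro ⟨i, hij, hD⟩
      rw [hget i (hij.trans hj)] at hD
      exact ⟨_, Fin.rev_lt_rev.2 hij, hD⟩
    · rintro ⟨k, hk, hD⟩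
      refine ⟨k.rev, Fin.rev_lt_iff.1 hk, ?_⟩
      rw [hget _ k.rev.2]
      change D ∈ faceSet Φ (F k.rev.rev)
      rwa [Fin.rev_rev]
  have hstar : ∀ j, 0 < j → j < L.length →
      ∃ γ : Fin d → ℤ, Z2R γ ∈ L.getD j ∅ ∧
        {D ∈ faceSet Φ (L.getD j ∅) | Z2R γ ∈ D} =
          faceSet Φ (L.getD j ∅) \ (⋃ i ∈ Finset.range j, faceSet Φ (L.getD i ∅)) ∧
        {a : Fin d → ℤ | ∃ D ∈ faceSet Φ (L.getD j ∅), Z2R γ ∈ D ∧ Z2R a ∈ relint D} =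
          {a : Fin d → ℤ | ∃ b : Fin d → ℤ, Z2R b ∈ L.getD j ∅ ∧ a = γ + b} := by
    intro j _ hj
    have hjn : j < n := by simpa [L] using hj
    obtain ⟨γ, hγ⟩ := htranslate (Fin.rev ⟨j, hjn⟩)
    have hFj := (hF (Fin.rev ⟨j, hjn⟩)).1
    rw [hunion j hjn, hget j hjn]
    refine ⟨γ, ((hγ γ).2 ⟨0, ?_, by simp⟩).1, Φ.star_of_translate hFj ?_ hγ⟩
    · rw [Z2R_zero]
      exact (Φ.isConvexCone hFj).1
    · rintro _ ⟨k, -, rfl⟩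
      exact (hF k).1
  refine ⟨L, Φ.isShelling_of_star (List.nodup_ofFn.2 (hFinj.comp Fin.rev_injective)) ?_
    fun j h0 hj => ?_, hstar⟩
  · ext D
    simp only [Set.mem_ofPred_eq, L, List.mem_ofFn]
    constructor
    · rintro ⟨i, rfl⟩
      exact hF _
    · intro hD
      obtain ⟨i, hi⟩ := (hmin _).2 ⟨D, hD, rfl⟩
      refine ⟨i.rev, ?_⟩
      obtain ⟨a, haD, ha⟩ := Φ.exists_facet_lattice_point hD
      rw [Fin.rev_rev]
      refine ha _ (hF i).1 ?_
      by_contra h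
      rw [hPF] at hi
      exact (Φ.xpow_mem_ker_iff K hD.1).1 (hi ▸ (Φ.xpow_mem_ker_iff K (hF i).1).2 h) haD
  · obtain ⟨γ, hγ, h1, -⟩ := hstar j h0 hj
    exact ⟨_, hγ, h1⟩
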